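/- Let φ : ℂ² → ℂ² be a smooth symplectomorphism and Σ the standard open Whitney umbrella. Then there exists ε > 0 sufficiently small such that every continuous complex-valued function on φ(Σ) ∩ B̄(φ(0), ε) can be uniformly approximated on this set by holomorphic polynomials in two variables. -/

import Mathlib

open Metric

noncomputable section

/-- The standard open Whitney umbrella parametrization `π(t,s) = (ts, 2t³/3, t², s)`
in real coordinates `(x,u,y,v)`, viewed in `ℂ² = ℂ × ℂ` with `z = x + iy`, `w = u + iv`. -/
def whitneyPi (p : ℝ × ℝ) : ℂ × ℂ :=
  (⟨p.1 * p.2, p.1 ^ 2⟩, ⟨2 * p.1 ^ 3 / 3, p.2⟩)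

/-- The standard symplectic form `ω_st = dx∧dy + du∧dv` on `ℝ⁴ ≅ ℂ²`. -/
def omegaSt (p q : ℂ × ℂ) : ℝ :=
  p.1.re * q.1.im - p.1.im * q.1.re + p.2.re * q.2.im - p.2.im * q.2.re

section

open Filter Topology

section ClosedSubalgebra

variable {X : Type*} [TopologicalSpace X] [CompactSpace X] {A : Subalgebra ℂ C(X, ℂ)}

theorem ContinuousMap.mem_of_forall_eq_comp (hA : IsClosed (A : Set C(X, ℂ))) {f : ℂ → ℂ}
    {r R : ℝ} (hr : 0 ≤ r) (hrR : r < R) (hf : DifferentiableOn ℂ f (closedBall 0 R))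
    {a b : C(X, ℂ)} (ha : a ∈ A) (har : ∀ x, ‖a x‖ < r) (hb : ∀ x, b x = f (a x)) : b ∈ A := by
  lift r to NNReal using hr
  have hR : 0 ≤ R := r.2.trans hrR.le
  lift R to NNReal using hR
  have hps := (hf.hasFPowerSeriesOnBall (pos_of_gt (by exact_mod_cast hrR))).tendstoUniformlyOn'
    (r' := r) (by exact_mod_cast hrR)
  set p := cauchyPowerSeries f 0 R
  let g : ℕ → C(X, ℂ) := fun n => ∑ k ∈ Finset.range n, p.coeff k • a ^ k
  have hgA : ∀ n, g n ∈ A := fun n =>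
    A.sum_mem fun k _ => A.smul_mem (A.pow_mem ha k) _
  have hlim : Tendsto g atTop (𝓝 b) := by
    rw [ContinuousMap.tendsto_iff_tendstoUniformly, Metric.tendstoUniformly_iff]
    intro ε hε
    filter_upwards [Metric.tendstoUniformlyOn_iff.1 hps ε hε] with n hn x
    have := hn (a x) (by simpa using har x)
    rw [hb x]
    convert this using 2
    simp [g, FormalMultilinearSeries.partialSum, p, mul_comm]
  exact hA.mem_of_tendsto hlim (Eventually.of_forall hgA)

theorem ContinuousMap.exp_mem (hA : IsClosed (A : Set C(X, ℂ))) {a b : C(X, ℂ)} (ha : a ∈ A)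
    (hb : ∀ x, b x = Complex.exp (a x)) : b ∈ A :=
  ContinuousMap.mem_of_forall_eq_comp hA (r := ‖a‖ + 1) (by positivity) (lt_add_one _)
    Complex.differentiable_exp.differentiableOn ha
    (fun x => (a.norm_coe_le_norm x).trans_lt (lt_add_one _)) hb

theorem ContinuousMap.one_add_inv_mem (hA : IsClosed (A : Set C(X, ℂ))) {a b : C(X, ℂ)}
    (ha : a ∈ A) (har : ∀ x, ‖a x‖ ≤ 1 / 2) (hb : ∀ x, b x * (1 + a x) = 1) : b ∈ A := by
  refine ContinuousMap.mem_of_forall_eq_comp hA (f := fun z => (1 + z)⁻¹) (r := 3 / 4)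
    (R := 4 / 5) (by norm_num) (by norm_num) ?_ ha
    (fun x => (har x).trans_lt (by norm_num)) (fun x => eq_inv_of_mul_eq_one_left (hb x))
  intro z hz
  have hz' : 1 + z ≠ 0 := by
    intro h
    have : z = -1 := by linear_combination h
    subst this
    norm_num at hz
  exact ((differentiableAt_id.const_add 1).inv hz').differentiableWithinAt

theorem Complex.re_sqrt_pos {w : ℂ} (hw : w ∈ Complex.slitPlane) : 0 < (w ^ (1 / 2 : ℂ)).re := by
  have h0 : w ≠ 0 := Complex.slitPlane_ne_zero hw
  rw [Complex.cpow_def_of_ne_zero h0, Complex.exp_re]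
  refine mul_pos (Real.exp_pos _) (Real.cos_pos_of_mem_Ioo ?_)
  have h1 := Complex.neg_pi_lt_arg w
  have h2 := lt_of_le_of_ne (Complex.arg_le_pi w) (Complex.mem_slitPlane_iff_arg.1 hw).1
  have : (Complex.log w * (1 / 2)).im = w.arg / 2 := by
    rw [show (1 / 2 : ℂ) = ((1 / 2 : ℝ) : ℂ) by norm_num, Complex.im_mul_ofReal, Complex.log_im]
    ring
  rw [this]
  constructor <;> linarith

theorem Complex.sqrt_sq (w : ℂ) : (w ^ (1 / 2 : ℂ)) ^ 2 = w := by
  simp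

theorem Complex.eq_of_sq_eq_sq_of_re_pos {z w : ℂ} (hz : 0 < z.re) (hw : 0 < w.re)
    (h : z ^ 2 = w ^ 2) : z = w := by
  rcases sq_eq_sq_iff_eq_or_eq_neg.1 h with h | h
  · exact h
  · have := congrArg Complex.re h
    simp at this
    linarith

theorem Complex.one_add_mem_slitPlane {z : ℂ} (hz : ‖z‖ < 1) : 1 + z ∈ Complex.slitPlane := by
  left
  have := (abs_le.1 (Complex.abs_re_le_norm z)).1
  simp
  linarith

theorem ContinuousMap.sqrt_one_add_mem (hA : IsClosed (A : Set C(X, ℂ))) {a b : C(X, ℂ)}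
    (ha : a ∈ A) (har : ∀ x, ‖a x‖ ≤ 1 / 2) (hb : ∀ x, b x ^ 2 = 1 + a x)
    (hb' : ∀ x, 0 < (b x).re) : b ∈ A := by
  refine ContinuousMap.mem_of_forall_eq_comp hA (f := fun z => (1 + z) ^ (1 / 2 : ℂ)) (r := 3 / 4)
    (R := 4 / 5) (by norm_num) (by norm_num) ?_ ha
    (fun x => (har x).trans_lt (by norm_num)) (fun x => ?_)
  · intro z hz
    have hz' := Complex.one_add_mem_slitPlane
      ((mem_closedBall_zero_iff.1 hz).trans_lt (by norm_num))
    exact ((differentiableAt_id.const_add 1).cpow_const hz').differentiableWithinAt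
  · refine Complex.eq_of_sq_eq_sq_of_re_pos (hb' x) (Complex.re_sqrt_pos ?_) ?_
    · exact Complex.one_add_mem_slitPlane ((har x).trans_lt (by norm_num))
    · rw [Complex.sqrt_sq, hb x]

theorem Complex.sq_add_ofReal_mem_slitPlane {q : ℂ} (hq : 0 < q.re ∨ q = 0) {l : ℝ} (hl : 0 < l) :
    q ^ 2 + l ∈ Complex.slitPlane := by
  rw [Complex.mem_slitPlane_iff]
  rcases hq with hq | rfl
  · by_cases him : q.im = 0
    · left
      simp [pow_two, him]
      positivity
    · right
      simp only [pow_two, add_im, mul_im, ofReal_im, add_zero]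
      intro h
      have : q.re * q.im = 0 := by linarith
      simp_all
  · left
    simpa using hl

theorem Complex.re_mul_conj_nonneg_of_sq_eq_sq_add {z w : ℂ} (hz : 0 ≤ z.re) (hw : 0 < w.re ∨ w = 0)
    {d : ℝ} (h : z ^ 2 = w ^ 2 + d) : 0 ≤ z.re * w.re + z.im * w.im := by
  rcases hw with hw | rfl
  · have h2 := congrArg Complex.im h
    simp only [pow_two, mul_im, add_im, ofReal_im, add_zero] at h2
    have h3 : z.re * z.im = w.re * w.im := by linarith
    rcases hz.eq_or_lt with hz | hz
    · have : w.im = 0 := by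
        rw [← hz, zero_mul] at h3
        simpa [hw.ne'] using h3.symm
      simp [← hz, this]
    · have : 0 ≤ z.im * w.im := by
        have h4 : 0 ≤ z.re * (z.im * w.im) := by
          rw [← mul_assoc, h3, mul_assoc]
          exact mul_nonneg hw.le (mul_self_nonneg _)
        exact nonneg_of_mul_nonneg_right h4 hz
      positivity
  · simp

theorem Complex.norm_sub_le_norm_add {z w : ℂ} (h : 0 ≤ z.re * w.re + z.im * w.im) :
    ‖z - w‖ ≤ ‖z + w‖ := by
  rw [← sq_le_sq₀ (norm_nonneg _) (norm_nonneg _), Complex.sq_norm, Complex.sq_norm,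
    Complex.normSq_apply, Complex.normSq_apply]
  simp only [sub_re, sub_im, add_re, add_im]
  nlinarith

theorem ContinuousMap.sqrt_mem_of_near (hA : IsClosed (A : Set C(X, ℂ))) {u v d u' v' : C(X, ℂ)}
    (hu : u ∈ A) (hv : v ∈ A) (hd : d ∈ A) (huv : ∀ x, u x ^ 2 * v x = 1)
    (hdv : ∀ x, ‖d x * v x‖ ≤ 1 / 2) (hu' : ∀ x, u' x ^ 2 = u x ^ 2 + d x)
    (huv' : ∀ x, u' x ^ 2 * v' x = 1)
    (hre : ∀ x, 0 ≤ (u' x).re * (u x).re + (u' x).im * (u x).im) : u' ∈ A ∧ v' ∈ A := by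
  have hdvA : d * v ∈ A := A.mul_mem hd hv
  have hslit : ∀ x, 1 + d x * v x ∈ Complex.slitPlane := fun x =>
    Complex.one_add_mem_slitPlane ((hdv x).trans_lt (by norm_num))
  let b : C(X, ℂ) := ⟨fun x => (1 + d x * v x) ^ (1 / 2 : ℂ), by
    refine continuous_iff_continuousAt.2 fun x => ContinuousAt.cpow ?_ continuousAt_const (hslit x)
    fun_prop⟩
  have hb2 : ∀ x, b x ^ 2 = 1 + d x * v x := fun x => Complex.sqrt_sq _
  have hbre : ∀ x, 0 < (b x).re := fun x => Complex.re_sqrt_pos (hslit x)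
  have hbA : b ∈ A := ContinuousMap.sqrt_one_add_mem hA hdvA hdv hb2 hbre
  have hu0 : ∀ x, u x ≠ 0 := fun x h => by simpa [h] using huv x
  have key : u' = u * b := by
    ext x
    have : u' x ^ 2 = (u x * b x) ^ 2 := by
      rw [mul_pow, hb2, hu']
      linear_combination (- d x) * huv x
    rcases sq_eq_sq_iff_eq_or_eq_neg.1 this with h | h
    · exact h
    · exfalso
      have h1 := hre x
      rw [h] at h1
      have h2 : 0 < Complex.normSq (u x) := Complex.normSq_pos.2 (hu0 x)
      have h3 := mul_pos (hbre x) h2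
      rw [Complex.normSq_apply] at h3
      simp only [Complex.neg_re, Complex.neg_im, Complex.mul_re, Complex.mul_im] at h1
      nlinarith
  refine ⟨key ▸ A.mul_mem hu hbA, ?_⟩
  let c : C(X, ℂ) := ⟨fun x => (1 + d x * v x)⁻¹, by
    refine Continuous.inv₀ (by fun_prop) fun x => Complex.slitPlane_ne_zero (hslit x)⟩
  have hc : ∀ x, c x * (1 + d x * v x) = 1 := fun x =>
    inv_mul_cancel₀ (Complex.slitPlane_ne_zero (hslit x))
  have hcA : c ∈ A := ContinuousMap.one_add_inv_mem hA hdvA hdv hc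
  have : v' = v * c := by
    ext x
    have h1 := huv' x
    rw [hu'] at h1
    have h2 := hc x
    have h3 := huv x
    have h4 : u x ^ 2 + d x ≠ 0 := fun h => by simp [h] at h1
    apply mul_left_cancel₀ h4
    rw [h1]
    change 1 = (u x ^ 2 + d x) * (v x * c x)
    linear_combination (-1 : ℂ) * h2 - c x * h3
  exact this ▸ A.mul_mem hv hcA

theorem ContinuousMap.sqrt_sq_add_mem (hA : IsClosed (A : Set C(X, ℂ))) {q : C(X, ℂ)}
    (hq2 : q ^ 2 ∈ A) (hq : ∀ x, 0 < (q x).re ∨ q x = 0) {l : ℝ} (hl : 0 < l) {u : C(X, ℂ)}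
    (hu : ∀ x, u x = (q x ^ 2 + l) ^ (1 / 2 : ℂ)) : u ∈ A := by
  have hslit : ∀ (l : ℝ) (_ : 0 < l) (x : X), q x ^ 2 + l ∈ Complex.slitPlane := fun l hl x =>
    Complex.sq_add_ofReal_mem_slitPlane (hq x) hl
  let U : Set.Ioi (0 : ℝ) → C(X, ℂ) := fun l => ⟨fun x => (q x ^ 2 + (l : ℝ)) ^ (1 / 2 : ℂ), by
    refine continuous_iff_continuousAt.2 fun x =>
      ContinuousAt.cpow ?_ continuousAt_const (hslit l l.2 x)
    fun_prop⟩
  let V : Set.Ioi (0 : ℝ) → C(X, ℂ) := fun l => ⟨fun x => (q x ^ 2 + (l : ℝ))⁻¹, by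
    refine Continuous.inv₀ (by fun_prop) fun x => Complex.slitPlane_ne_zero (hslit l l.2 x)⟩
  have hU2 : ∀ l x, U l x ^ 2 = q x ^ 2 + (l : ℝ) := fun l x => Complex.sqrt_sq _
  have hUV : ∀ l x, U l x ^ 2 * V l x = 1 := fun l x => by
    rw [hU2]
    exact mul_inv_cancel₀ (Complex.slitPlane_ne_zero (hslit l l.2 x))
  have hUre : ∀ l x, 0 < (U l x).re := fun l x => Complex.re_sqrt_pos (hslit l l.2 x)
  have hconst : ∀ c : ℂ, ContinuousMap.const X c ∈ A := fun c => A.algebraMap_mem c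
  obtain ⟨L, hlL, hL⟩ : ∃ L : ℝ, l ≤ L ∧ 2 * ‖q ^ 2‖ ≤ L :=
    ⟨max l (2 * ‖q ^ 2‖), le_max_left _ _, le_max_right _ _⟩
  have hL0 : 0 < L := hl.trans_le hlL
  have hbase : U ⟨L, hL0⟩ ∈ A ∧ V ⟨L, hL0⟩ ∈ A := by
    have hsq : ((√L : ℝ) : ℂ) ^ 2 = L := by
      rw [← Complex.ofReal_pow, Real.sq_sqrt hL0.le]
    have hLC : (L : ℂ) ≠ 0 := by exact_mod_cast hL0.ne'
    refine ContinuousMap.sqrt_mem_of_near hA (hconst ((√L : ℝ) : ℂ)) (hconst ((L : ℂ)⁻¹)) hq2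
      (fun x => ?_) (fun x => ?_) (fun x => ?_) (hUV _) (fun x => ?_)
    · simp only [ContinuousMap.const_apply, hsq]
      exact mul_inv_cancel₀ hLC
    · simp only [ContinuousMap.const_apply, norm_mul, norm_inv, Complex.norm_real,
        Real.norm_of_nonneg hL0.le]
      rw [← div_eq_mul_inv, div_le_iff₀ hL0]
      have := (q ^ 2).norm_coe_le_norm x
      linarith
    · rw [hU2]
      simp [hsq, add_comm]
    · have := hUre ⟨L, hL0⟩ x
      simp only [ContinuousMap.const_apply, Complex.ofReal_re, Complex.ofReal_im, mul_zero,
        add_zero]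
      positivity
  obtain ⟨m, hm, hmle⟩ := (isCompact_Icc (a := l) (b := L)).prod (isCompact_univ (X := X))
    |>.exists_forall_le' (f := fun y : ℝ × X => ‖q y.2 ^ 2 + (y.1 : ℂ)‖) (a := 0)
    (by fun_prop) (fun y hy => norm_pos_iff.2
      (Complex.slitPlane_ne_zero (hslit y.1 (hl.trans_le hy.1.1) y.2)))
  obtain ⟨n, hn⟩ := exists_nat_ge (2 * (L - l) / m)
  have hn' : 2 * (L - l) ≤ (n + 1) * m := by
    rw [div_le_iff₀ hm] at hn
    linarith
  set e : ℝ := (L - l) / (n + 1) with he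
  have he0 : 0 ≤ e := div_nonneg (by linarith) (by positivity)
  have hem : e ≤ m / 2 := by
    rw [he, div_le_iff₀ (by positivity)]
    linarith
  have hen : (n + 1) * e = L - l := by
    rw [he]
    field_simp
  have hpos : ∀ k : ℕ, k ≤ n + 1 → l ≤ L - k * e := fun k hk => by
    have : (k : ℝ) * e ≤ (n + 1) * e := by
      gcongr
      exact_mod_cast hk
    linarith
  have hstep : ∀ (k : ℕ) (hk : k ≤ n + 1), U ⟨L - k * e, hl.trans_le (hpos k hk)⟩ ∈ A ∧
      V ⟨L - k * e, hl.trans_le (hpos k hk)⟩ ∈ A := by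
    intro k
    induction k with
    | zero =>
      intro hk
      convert hbase using 4 <;> simp
    | succ k ih =>
      intro hk
      obtain ⟨h1, h2⟩ := ih (by omega)
      refine ContinuousMap.sqrt_mem_of_near hA h1 h2 (hconst (-(e : ℂ)))
        (hUV _) (fun x => ?_) (fun x => ?_) (hUV _) (fun x => ?_)
      · have hx := hmle (L - k * e, x) ⟨⟨hpos k (by omega), by
          have : 0 ≤ k * e := by positivity
          simp only
          linarith⟩, Set.mem_univ _⟩
        simp only [ContinuousMap.const_apply, norm_mul, norm_neg, Complex.norm_real,
          Real.norm_of_nonneg he0]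
        change e * ‖(q x ^ 2 + ((L - k * e : ℝ) : ℂ))⁻¹‖ ≤ 1 / 2
        rw [norm_inv, ← div_eq_mul_inv, div_le_iff₀ (hm.trans_le hx)]
        linarith
      · rw [hU2, hU2]
        simp only [ContinuousMap.const_apply]
        push_cast
        ring
      · refine Complex.re_mul_conj_nonneg_of_sq_eq_sq_add (d := -e) (hUre _ x).le
          (Or.inl (hUre _ x)) ?_
        rw [hU2, hU2]
        push_cast
        ring
  have hfin := (hstep (n + 1) le_rfl).1
  convert hfin
  ext x
  rw [hu x]
  have : L - ((n + 1 : ℕ) : ℝ) * e = l := by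
    push_cast
    linarith
  change _ = (q x ^ 2 + ((L - ((n + 1 : ℕ) : ℝ) * e : ℝ) : ℂ)) ^ (1 / 2 : ℂ)
  rw [this]

theorem ContinuousMap.mem_of_sq_mem (hA : IsClosed (A : Set C(X, ℂ))) {q : C(X, ℂ)}
    (hq2 : q ^ 2 ∈ A) (hq : ∀ x, 0 < (q x).re ∨ q x = 0) : q ∈ A := by
  rw [← SetLike.mem_coe, ← hA.closure_eq, Metric.mem_closure_iff]
  intro ε hε
  have hl : 0 < (ε / 2) ^ 2 := by positivity
  have hslit := fun x => Complex.sq_add_ofReal_mem_slitPlane (hq x) hl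
  let u : C(X, ℂ) := ⟨fun x => (q x ^ 2 + ((ε / 2) ^ 2 : ℝ)) ^ (1 / 2 : ℂ), by
    refine continuous_iff_continuousAt.2 fun x =>
      ContinuousAt.cpow ?_ continuousAt_const (hslit x)
    fun_prop⟩
  refine ⟨u, ContinuousMap.sqrt_sq_add_mem hA hq2 hq hl fun x => rfl, ?_⟩
  refine lt_of_le_of_lt ?_ (half_lt_self hε)
  rw [dist_comm, ContinuousMap.dist_le (by positivity)]
  intro x
  have hux : u x ^ 2 = q x ^ 2 + ((ε / 2) ^ 2 : ℝ) := Complex.sqrt_sq _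
  have h1 := Complex.norm_sub_le_norm_add (Complex.re_mul_conj_nonneg_of_sq_eq_sq_add
    (Complex.re_sqrt_pos (hslit x)).le (hq x) hux)
  rw [dist_eq_norm]
  refine le_of_sq_le_sq ?_ (by positivity)
  calc ‖u x - q x‖ ^ 2 ≤ ‖u x - q x‖ * ‖u x + q x‖ := by
        rw [pow_two]
        gcongr
        exact h1
    _ = ‖(((ε / 2) ^ 2 : ℝ) : ℂ)‖ := by
        rw [← norm_mul]
        congr 1
        linear_combination hux
    _ = (ε / 2) ^ 2 := by
        rw [Complex.norm_real, Real.norm_of_nonneg hl.le]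

theorem Subalgebra.eq_top_of_adjoin_sqrt [T2Space X] (hA : IsClosed (A : Set C(X, ℂ)))
    {v w : C(X, ℂ)} {x₀ : X} (hw : w ∈ A) (hv : v ^ 2 ∈ A) (hvw : v * w ∈ A)
    (hw0 : ∀ x, w x = 0 → x = x₀)
    (htop : (Algebra.adjoin ℂ (insert v (A : Set C(X, ℂ)))).topologicalClosure = ⊤) : A = ⊤ := by
  have hsum : ∀ f ∈ Algebra.adjoin ℂ (insert v (A : Set C(X, ℂ))),
      ∃ a ∈ A, ∃ b ∈ A, f = a + v * b := by
    intro f hf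
    induction hf using Algebra.adjoin_induction with
    | mem f hf =>
      rcases hf with rfl | hf
      · exact ⟨0, A.zero_mem, 1, A.one_mem, by simp⟩
      · exact ⟨f, hf, 0, A.zero_mem, by simp⟩
    | algebraMap r => exact ⟨_, A.algebraMap_mem r, 0, A.zero_mem, by simp⟩
    | add f g _ _ hf hg =>
      obtain ⟨a, ha, b, hb, rfl⟩ := hf
      obtain ⟨c, hc, d, hd, rfl⟩ := hg
      exact ⟨a + c, A.add_mem ha hc, b + d, A.add_mem hb hd, by ring⟩
    | mul f g _ _ hf hg =>
      obtain ⟨a, ha, b, hb, rfl⟩ := hf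
      obtain ⟨c, hc, d, hd, rfl⟩ := hg
      exact ⟨a * c + v ^ 2 * (b * d), A.add_mem (A.mul_mem ha hc) (A.mul_mem hv (A.mul_mem hb hd)),
        a * d + b * c, A.add_mem (A.mul_mem ha hd) (A.mul_mem hb hc), by ring⟩
  have hmul : ∀ f : C(X, ℂ), w * f ∈ A := by
    intro f
    have hf : f ∈ closure (Algebra.adjoin ℂ (insert v (A : Set C(X, ℂ))) : Set C(X, ℂ)) := by
      rw [← Subalgebra.topologicalClosure_coe, htop]
      trivial
    have hcl : IsClosed {f : C(X, ℂ) | w * f ∈ A} := hA.preimage (continuous_const_mul w)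
    refine closure_minimal (fun g hg => ?_) hcl hf
    obtain ⟨a, ha, b, hb, rfl⟩ := hsum g hg
    have : w * (a + v * b) = w * a + v * w * b := by ring
    rw [Set.mem_ofPred_eq, this]
    exact A.add_mem (A.mul_mem hw ha) (A.mul_mem hvw hb)
  have hideal : ∀ f : C(X, ℂ), f x₀ = 0 → f ∈ A := by
    intro f hf
    have h1 : f ∈ (Ideal.span {w}).closure := by
      rw [← ContinuousMap.idealOfSet_ofIdeal_eq_closure, ContinuousMap.mem_idealOfSet]
      intro x hx
      rw [Set.mem_compl_iff, ContinuousMap.notMem_setOfIdeal] at hx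
      rw [hw0 x (hx (Ideal.mem_span_singleton_self w)), hf]
    rw [← SetLike.mem_coe, Ideal.coe_closure] at h1
    refine closure_minimal (fun g hg => ?_) hA h1
    obtain ⟨c, rfl⟩ := Ideal.mem_span_singleton'.1 hg
    rw [mul_comm]
    exact hmul c
  rw [eq_top_iff]
  intro f _
  have h1 := hideal (f - algebraMap ℂ C(X, ℂ) (f x₀)) (by simp)
  simpa using A.add_mem h1 (A.algebraMap_mem (f x₀))

end ClosedSubalgebra

end

section

open Filter Topology MeasureTheory

section Gaussian

/-- The squared Euclidean length of `h`. -/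
def sqLen (h : ℝ × ℝ) : ℝ := h.1 ^ 2 + h.2 ^ 2

theorem sqLen_nonneg (h : ℝ × ℝ) : 0 ≤ sqLen h := by
  unfold sqLen
  positivity

theorem sq_norm_le_sqLen (h : ℝ × ℝ) : ‖h‖ ^ 2 ≤ sqLen h := by
  unfold sqLen
  rw [Prod.norm_def]
  rcases max_choice ‖h.1‖ ‖h.2‖ with H | H <;> rw [H, Real.norm_eq_abs, sq_abs] <;>
    nlinarith [sq_nonneg h.1, sq_nonneg h.2]

theorem integrable_exp_neg_mul_sqLen {b : ℝ} (hb : 0 < b) :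
    Integrable fun h : ℝ × ℝ => Real.exp (-b * sqLen h) := by
  have := (integrable_exp_neg_mul_sq hb).mul_prod (integrable_exp_neg_mul_sq hb)
  refine this.congr (Eventually.of_forall fun h => ?_)
  simp only [sqLen, ← Real.exp_add]
  ring_nf

theorem integral_exp_neg_mul_sqLen {b : ℝ} (hb : 0 < b) :
    ∫ h : ℝ × ℝ, Real.exp (-b * sqLen h) = Real.pi / b := by
  have := integral_prod_mul (μ := (volume : Measure ℝ)) (ν := (volume : Measure ℝ))
    (fun x : ℝ => Real.exp (-b * x ^ 2)) (fun x : ℝ => Real.exp (-b * x ^ 2))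
  rw [integral_gaussian, Real.mul_self_sqrt (by positivity)] at this
  rw [← this, Measure.volume_eq_prod]
  congr 1
  ext h
  simp only [sqLen, ← Real.exp_add]
  ring_nf

theorem integrable_exp_neg_mul_sqLen_sub {b : ℝ} (hb : 0 < b) (x : ℝ × ℝ) :
    Integrable fun y : ℝ × ℝ => Real.exp (-b * sqLen (x - y)) :=
  (integrable_exp_neg_mul_sqLen hb).comp_sub_left x

theorem integral_exp_neg_mul_sqLen_sub {b : ℝ} (hb : 0 < b) (x : ℝ × ℝ) :
    ∫ y : ℝ × ℝ, Real.exp (-b * sqLen (x - y)) = Real.pi / b := by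
  rw [integral_sub_left_eq_self (fun h => Real.exp (-b * sqLen h)) volume x,
    integral_exp_neg_mul_sqLen hb]

/-- The sum of the squares of the increments of two complex functions. -/
def sqDiff (F₁ F₂ : ℝ × ℝ → ℂ) (x y : ℝ × ℝ) : ℂ := (F₁ x - F₁ y) ^ 2 + (F₂ x - F₂ y) ^ 2

variable {F₁ F₂ : ℝ × ℝ → ℂ}

theorem norm_sqDiff_sub_sqLen_le {E₁ E₂ : ℝ × ℝ → ℂ} (hE₁ : LipschitzWith (1 / 100) E₁)
    (hE₂ : LipschitzWith (1 / 100) E₂) (hF₁ : ∀ x, F₁ x = x.1 + E₁ x)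
    (hF₂ : ∀ x, F₂ x = x.2 + E₂ x) (x y : ℝ × ℝ) :
    ‖sqDiff F₁ F₂ x y - sqLen (x - y)‖ ≤ 1 / 20 * sqLen (x - y) := by
  have h1 : ‖E₁ x - E₁ y‖ ≤ 1 / 100 * ‖x - y‖ := by simpa using hE₁.norm_sub_le x y
  have h2 : ‖E₂ x - E₂ y‖ ≤ 1 / 100 * ‖x - y‖ := by simpa using hE₂.norm_sub_le x y
  have h3 : ‖((x.1 - y.1 : ℝ) : ℂ)‖ ≤ ‖x - y‖ := by
    rw [Complex.norm_real]
    exact norm_fst_le (x - y)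
  have h4 : ‖((x.2 - y.2 : ℝ) : ℂ)‖ ≤ ‖x - y‖ := by
    rw [Complex.norm_real]
    exact norm_snd_le (x - y)
  have hN := norm_nonneg (x - y)
  have : sqDiff F₁ F₂ x y - sqLen (x - y) =
      2 * (((x.1 - y.1 : ℝ) : ℂ) * (E₁ x - E₁ y)) + 2 * (((x.2 - y.2 : ℝ) : ℂ) * (E₂ x - E₂ y)) +
        (E₁ x - E₁ y) ^ 2 + (E₂ x - E₂ y) ^ 2 := by
    simp only [sqDiff, sqLen, hF₁, hF₂, Prod.fst_sub, Prod.snd_sub]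
    push_cast
    ring
  rw [this]
  refine (norm_add₄_le).trans ?_
  simp only [norm_mul, norm_pow, Complex.norm_ofNat]
  calc _ ≤ 2 * (‖x - y‖ * (1 / 100 * ‖x - y‖)) + 2 * (‖x - y‖ * (1 / 100 * ‖x - y‖)) +
        (1 / 100 * ‖x - y‖) ^ 2 + (1 / 100 * ‖x - y‖) ^ 2 := by gcongr
    _ ≤ 1 / 20 * ‖x - y‖ ^ 2 := by nlinarith
    _ ≤ _ := by
      gcongr
      exact sq_norm_le_sqLen _

theorem norm_exp_neg_mul_sqDiff_le
    (hQ : ∀ x y, ‖sqDiff F₁ F₂ x y - sqLen (x - y)‖ ≤ 1 / 20 * sqLen (x - y)) {k : ℝ} (hk : 0 < k)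
    (x y : ℝ × ℝ) : ‖Complex.exp (-k * sqDiff F₁ F₂ x y)‖ ≤ Real.exp (-(k / 2) * sqLen (x - y)) :=
        by
  rw [Complex.norm_exp]
  apply Real.exp_le_exp.2
  have h1 := (abs_le.1 ((Complex.abs_re_le_norm _).trans (hQ x y))).1
  have h2 := sqLen_nonneg (x - y)
  simp only [Complex.sub_re, Complex.ofReal_re] at h1
  have : (-(k : ℂ) * sqDiff F₁ F₂ x y).re = -k * (sqDiff F₁ F₂ x y).re := by
    rw [← Complex.ofReal_neg, Complex.re_ofReal_mul]
  rw [this]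
  nlinarith

theorem norm_exp_neg_mul_sqDiff_sub_le
    (hQ : ∀ x y, ‖sqDiff F₁ F₂ x y - sqLen (x - y)‖ ≤ 1 / 20 * sqLen (x - y)) {k : ℝ} (hk : 0 < k)
    (x y : ℝ × ℝ) : ‖Complex.exp (-k * sqDiff F₁ F₂ x y) - Real.exp (-k * sqLen (x - y))‖ ≤
      1 / 9 * Real.exp (-(k / 2) * sqLen (x - y)) := by
  set L := sqLen (x - y) with hL
  set z : ℂ := -k * (sqDiff F₁ F₂ x y - L) with hz
  have hL0 : 0 ≤ L := sqLen_nonneg (x - y)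
  have hzn : ‖z‖ ≤ 1 / 20 * (k * L) := by
    rw [hz, norm_mul, norm_neg, Complex.norm_real, Real.norm_of_nonneg hk.le]
    calc _ ≤ k * (1 / 20 * L) := by
          gcongr
          exact hQ x y
      _ = _ := by ring
  have h1 : Complex.exp (-k * sqDiff F₁ F₂ x y) - Real.exp (-k * L) =
      Real.exp (-k * L) * (Complex.exp z - 1) := by
    rw [mul_sub, mul_one, Complex.ofReal_exp, ← Complex.exp_add]
    congr 2
    rw [hz]
    push_cast
    ring
  rw [h1, norm_mul, Complex.norm_real, Real.norm_of_nonneg (Real.exp_pos _).le]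
  have h2 : ‖Complex.exp z - 1‖ ≤ ‖z‖ * Real.exp ‖z‖ := by
    simpa using Complex.norm_exp_sub_sum_le_norm_mul_exp z 1
  have h3 : 9 / 20 * (k * L) ≤ Real.exp (9 / 20 * (k * L)) := by
    have := Real.add_one_le_exp (9 / 20 * (k * L))
    linarith
  calc _ ≤ Real.exp (-k * L) * (1 / 20 * (k * L) * Real.exp (1 / 20 * (k * L))) := by
        gcongr
        exact h2.trans (by gcongr)
    _ = 1 / 9 * ((9 / 20 * (k * L)) * (Real.exp (-k * L) * Real.exp (1 / 20 * (k * L)))) := by ring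
    _ ≤ 1 / 9 * (Real.exp (9 / 20 * (k * L)) * (Real.exp (-k * L) * Real.exp (1 / 20 * (k * L)))) :=
        by
        gcongr
    _ = _ := by
        rw [← Real.exp_add, ← Real.exp_add]
        ring_nf

theorem continuous_sqDiff (hF₁ : Continuous F₁) (hF₂ : Continuous F₂) :
    Continuous fun p : (ℝ × ℝ) × (ℝ × ℝ) => sqDiff F₁ F₂ p.1 p.2 := by
  unfold sqDiff
  fun_prop

theorem integrable_exp_neg_mul_sqDiff (hF₁ : Continuous F₁) (hF₂ : Continuous F₂)
    (hQ : ∀ x y, ‖sqDiff F₁ F₂ x y - sqLen (x - y)‖ ≤ 1 / 20 * sqLen (x - y)) {k : ℝ} (hk : 0 < k)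
    (x : ℝ × ℝ) : Integrable fun y => Complex.exp (-k * sqDiff F₁ F₂ x y) := by
  refine (integrable_exp_neg_mul_sqLen_sub (half_pos hk) x).mono' ?_
    (Eventually.of_forall fun y => norm_exp_neg_mul_sqDiff_le hQ hk x y)
  have := (continuous_sqDiff hF₁ hF₂).comp (Continuous.prodMk_right x)
  exact (Complex.continuous_exp.comp (continuous_const.mul this)).aestronglyMeasurable

theorem norm_integral_exp_neg_mul_sqDiff_sub_one_le (hF₁ : Continuous F₁) (hF₂ : Continuous F₂)
    (hQ : ∀ x y, ‖sqDiff F₁ F₂ x y - sqLen (x - y)‖ ≤ 1 / 20 * sqLen (x - y)) {k : ℝ} (hk : 0 < k)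
    (x : ℝ × ℝ) : ‖(k / Real.pi : ℝ) * (∫ y, Complex.exp (-k * sqDiff F₁ F₂ x y)) - 1‖ ≤ 2 / 9 := by
  have hc : 0 < k / Real.pi := by positivity
  have hone : (1 : ℂ) = (k / Real.pi : ℝ) * ∫ y, (Real.exp (-k * sqLen (x - y)) : ℂ) := by
    rw [integral_complex_ofReal, integral_exp_neg_mul_sqLen_sub hk, ← Complex.ofReal_mul]
    field_simp
    simp
  have hfi : Integrable fun y => (Real.exp (-k * sqLen (x - y)) : ℂ) :=
    (integrable_exp_neg_mul_sqLen_sub hk x).ofReal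
  rw [hone, ← mul_sub, norm_mul, Complex.norm_real, Real.norm_of_nonneg hc.le,
    ← integral_sub (integrable_exp_neg_mul_sqDiff hF₁ hF₂ hQ hk x) hfi]
  have := norm_integral_le_of_norm_le
    ((integrable_exp_neg_mul_sqLen_sub (half_pos hk) x).const_mul (1 / 9))
    (Eventually.of_forall fun y => norm_exp_neg_mul_sqDiff_sub_le hQ hk x y)
  rw [integral_const_mul, integral_exp_neg_mul_sqLen_sub (half_pos hk)] at this
  calc _ ≤ k / Real.pi * (1 / 9 * (Real.pi / (k / 2))) := by gcongr
    _ = 2 / 9 := by field_simp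

theorem norm_integral_exp_neg_mul_sqDiff_mul_sub_le (hF₁ : Continuous F₁) (hF₂ : Continuous F₂)
    (hQ : ∀ x y, ‖sqDiff F₁ F₂ x y - sqLen (x - y)‖ ≤ 1 / 20 * sqLen (x - y))
    {g : ℝ × ℝ → ℂ} (hg : Continuous g) (hgc : HasCompactSupport g) {ε : ℝ} (hε : 0 < ε) :
    ∀ᶠ k : ℝ in atTop, ∀ x, ‖(k / Real.pi : ℝ) * (∫ y, Complex.exp (-k * sqDiff F₁ F₂ x y) * g y) -
      g x * ((k / Real.pi : ℝ) * ∫ y, Complex.exp (-k * sqDiff F₁ F₂ x y))‖ ≤ ε := by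
  obtain ⟨M, hM⟩ := hgc.exists_bound_of_continuous hg
  have hM0 : 0 ≤ M := (norm_nonneg _).trans (hM 0)
  obtain ⟨δ, hδ, hδg⟩ := Metric.uniformContinuous_iff.1
    (hgc.uniformContinuous_of_continuous hg) (ε / 4) (by positivity)
  filter_upwards [eventually_gt_atTop 0, eventually_ge_atTop (64 * M / (ε * δ ^ 2))] with k hk hk2 x
  have hc : 0 < k / Real.pi := by positivity
  have hI := integrable_exp_neg_mul_sqDiff hF₁ hF₂ hQ hk x
  have hIg : Integrable fun y => Complex.exp (-k * sqDiff F₁ F₂ x y) * g y :=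
    hI.mul_bdd hg.aestronglyMeasurable (Eventually.of_forall hM)
  have h1 : (k / Real.pi : ℝ) * (∫ y, Complex.exp (-k * sqDiff F₁ F₂ x y) * g y) -
      g x * ((k / Real.pi : ℝ) * ∫ y, Complex.exp (-k * sqDiff F₁ F₂ x y)) =
      (k / Real.pi : ℝ) * ∫ y, Complex.exp (-k * sqDiff F₁ F₂ x y) * (g y - g x) := by
    simp only [mul_sub]
    rw [integral_sub hIg (hI.mul_const _), integral_mul_const]
    ring
  rw [h1, norm_mul, Complex.norm_real, Real.norm_of_nonneg hc.le]
  have hbd : ∀ y, ‖Complex.exp (-k * sqDiff F₁ F₂ x y) * (g y - g x)‖ ≤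
      ε / 4 * Real.exp (-(k / 2) * sqLen (x - y)) +
        8 * M / (k * δ ^ 2) * Real.exp (-(k / 4) * sqLen (x - y)) := by
    intro y
    set L := sqLen (x - y) with hL
    have hL0 : 0 ≤ L := sqLen_nonneg _
    have hgd : ‖g y - g x‖ ≤ ε / 4 + 2 * M / δ ^ 2 * L := by
      by_cases hxy : dist y x < δ
      · have := (hδg hxy).le
        rw [dist_eq_norm] at this
        exact this.trans (le_add_of_nonneg_right (by positivity))
      · have h2 : δ ≤ ‖x - y‖ := by
          rw [← dist_eq_norm, dist_comm]
          exact not_lt.1 hxy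
        have h3 : δ ^ 2 ≤ L := (pow_le_pow_left₀ hδ.le h2 2).trans (sq_norm_le_sqLen _)
        calc ‖g y - g x‖ ≤ M + M := (norm_sub_le _ _).trans (add_le_add (hM y) (hM x))
          _ = 2 * M / δ ^ 2 * δ ^ 2 := by field_simp; ring
          _ ≤ 2 * M / δ ^ 2 * L := by gcongr
          _ ≤ _ := le_add_of_nonneg_left (by positivity)
    have h4 : k / 4 * L ≤ Real.exp (k / 4 * L) := by
      have := Real.add_one_le_exp (k / 4 * L)
      linarith
    rw [norm_mul]
    calc _ ≤ Real.exp (-(k / 2) * L) * (ε / 4 + 2 * M / δ ^ 2 * L) := by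
          gcongr
          exact norm_exp_neg_mul_sqDiff_le hQ hk x y
      _ = ε / 4 * Real.exp (-(k / 2) * L) +
          8 * M / (k * δ ^ 2) * (k / 4 * L * Real.exp (-(k / 2) * L)) := by
          field_simp
          ring
      _ ≤ ε / 4 * Real.exp (-(k / 2) * L) +
          8 * M / (k * δ ^ 2) * (Real.exp (k / 4 * L) * Real.exp (-(k / 2) * L)) := by gcongr
      _ = _ := by
          rw [← Real.exp_add]
          ring_nf
  have := norm_integral_le_of_norm_le
    (((integrable_exp_neg_mul_sqLen_sub (half_pos hk) x).const_mul (ε / 4)).add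
      ((integrable_exp_neg_mul_sqLen_sub (b := k / 4) (by positivity) x).const_mul
        (8 * M / (k * δ ^ 2)))) (Eventually.of_forall hbd)
  simp only [Pi.add_apply] at this
  rw [integral_add ((integrable_exp_neg_mul_sqLen_sub (half_pos hk) x).const_mul (ε / 4))
    ((integrable_exp_neg_mul_sqLen_sub (b := k / 4) (by positivity) x).const_mul _),
    integral_const_mul, integral_const_mul, integral_exp_neg_mul_sqLen_sub (half_pos hk),
    integral_exp_neg_mul_sqLen_sub (by positivity : 0 < k / 4)] at this
  calc _ ≤ k / Real.pi * (ε / 4 * (Real.pi / (k / 2)) +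
        8 * M / (k * δ ^ 2) * (Real.pi / (k / 4))) := by gcongr
    _ = ε / 2 + 32 * M / (k * δ ^ 2) := by
        field_simp
        ring
    _ ≤ ε / 2 + ε / 2 := by
        have : 32 * M / (k * δ ^ 2) ≤ ε / 2 := by
          rw [div_le_iff₀ (by positivity)] at hk2 ⊢
          linarith
        gcongr
    _ = ε := by ring

theorem Subalgebra.integral_mem_of_isClosed {X α : Type*} [TopologicalSpace X] [CompactSpace X]
    [MeasurableSpace α] {μ : Measure α} {B : Subalgebra ℂ C(X, ℂ)}
    (hB : IsClosed (B : Set C(X, ℂ))) {f : α → C(X, ℂ)} (hf : ∀ y,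
        f y ∈ B) (hfi : Integrable f μ) :
    ∫ y, f y ∂μ ∈ B := by
  let S : Submodule ℂ C(X, ℂ) := Subalgebra.toSubmodule B
  have : IsClosed (S : Set C(X, ℂ)) := hB
  have h1 := S.mkQL.integral_comp_comm hfi
  have h2 : ∀ y, S.mkQL (f y) = 0 := fun y => (Submodule.Quotient.mk_eq_zero S).2 (hf y)
  simp only [h2, integral_zero] at h1
  exact (Submodule.Quotient.mk_eq_zero S).1 h1.symm

theorem Subalgebra.eq_top_of_lipschitz_perturbation {K : Set (ℝ × ℝ)} [CompactSpace K]
    {B : Subalgebra ℂ C(K, ℂ)} (hB : IsClosed (B : Set C(K, ℂ))) {E₁ E₂ : ℝ × ℝ → ℂ}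
    (hE₁ : LipschitzWith (1 / 100) E₁) (hE₂ : LipschitzWith (1 / 100) E₂) {f₁ f₂ : C(K, ℂ)}
    (hf₁ : f₁ ∈ B) (hf₂ : f₂ ∈ B) (h₁ : ∀ x : K, f₁ x = x.1.1 + E₁ x) (h₂ : ∀ x : K, f₂ x = x.1.2 +
        E₂ x) :
    B = ⊤ := by
  set F₁ : ℝ × ℝ → ℂ := fun x => x.1 + E₁ x with hF₁
  set F₂ : ℝ × ℝ → ℂ := fun x => x.2 + E₂ x with hF₂
  have hF₁c : Continuous F₁ := by
    have := hE₁.continuous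
    fun_prop
  have hF₂c : Continuous F₂ := by
    have := hE₂.continuous
    fun_prop
  have hQ := norm_sqDiff_sub_sqLen_le (F₁ := F₁) (F₂ := F₂) hE₁ hE₂ (fun x => rfl) (fun x => rfl)
  have hKc : IsCompact K := isCompact_iff_compactSpace.2 inferInstance
  let T : ℝ → (ℝ × ℝ → ℂ) → K → ℂ := fun k g x =>
    (k / Real.pi : ℝ) * ∫ y, Complex.exp (-k * sqDiff F₁ F₂ x y) * g y
  have hT : ∀ k g, Continuous g → HasCompactSupport g → ∃ h ∈ B, ∀ x, h x = T k g x := by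
    intro k g hg hgc
    let Φ : C(ℝ × ℝ, C(K, ℂ)) := ContinuousMap.curry
      ⟨fun p : (ℝ × ℝ) × K => Complex.exp (-k * sqDiff F₁ F₂ p.2 p.1) * g p.1, by
        have := (continuous_sqDiff hF₁c hF₂c).comp
          (Continuous.prodMk (continuous_subtype_val.comp continuous_snd) continuous_fst :
            Continuous fun p : (ℝ × ℝ) × K => ((p.2 : ℝ × ℝ), p.1))
        exact (Complex.continuous_exp.comp (continuous_const.mul this)).mul
          (hg.comp continuous_fst)⟩
    have hΦ : ∀ y x, Φ y x = Complex.exp (-k * sqDiff F₁ F₂ x y) * g y := fun y x => rfl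
    have hΦs : HasCompactSupport Φ := by
      refine hgc.mono fun y hy => ?_
      contrapose! hy
      rw [Function.notMem_support] at hy ⊢
      ext x
      simp [hΦ, hy]
    have hΦi : Integrable Φ := Φ.continuous.integrable_of_hasCompactSupport hΦs
    have hΦB : ∀ y, Φ y ∈ B := by
      intro y
      let q : C(K, ℂ) := (-k : ℂ) • ((f₁ - algebraMap ℂ C(K, ℂ) (F₁ y)) ^ 2 +
        (f₂ - algebraMap ℂ C(K, ℂ) (F₂ y)) ^ 2)
      have hq : q ∈ B := B.smul_mem (B.add_mem
        (B.pow_mem (B.sub_mem hf₁ (B.algebraMap_mem _)) 2)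
        (B.pow_mem (B.sub_mem hf₂ (B.algebraMap_mem _)) 2)) _
      let e : C(K, ℂ) := ⟨fun x => Complex.exp (q x), by fun_prop⟩
      have he : e ∈ B := ContinuousMap.exp_mem hB hq fun x => rfl
      have : Φ y = g y • e := by
        ext x
        rw [hΦ]
        simp only [e, q, sqDiff, hF₁, hF₂, h₁, h₂, ContinuousMap.smul_apply,
          ContinuousMap.add_apply, ContinuousMap.sub_apply, ContinuousMap.pow_apply,
          Algebra.algebraMap_eq_smul_one, ContinuousMap.one_apply, ContinuousMap.coe_mk,
              smul_eq_mul, mul_one]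
        rw [mul_comm]
      exact this ▸ B.smul_mem he _
    refine ⟨((k / Real.pi : ℝ) : ℂ) • ∫ y, Φ y,
      B.smul_mem (Subalgebra.integral_mem_of_isClosed hB hΦB hΦi) _, fun x => ?_⟩
    have := (ContinuousMap.evalCLM ℂ x).integral_comp_comm hΦi
    simp only [ContinuousMap.evalCLM_apply, hΦ] at this
    simp only [ContinuousMap.smul_apply, smul_eq_mul, T, this]
  obtain ⟨R, hR⟩ := hKc.isBounded.subset_closedBall (0 : ℝ × ℝ)
  let χ : ContDiffBump (0 : ℝ × ℝ) := ⟨|R| + 1, |R| + 2, by positivity, by linarith⟩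
  have hχ1 : ∀ x : K, χ x = 1 := fun x => χ.one_of_mem_closedBall (by
    refine closedBall_subset_closedBall ?_ (hR x.2)
    exact (le_abs_self R).trans (le_add_of_nonneg_right zero_le_one))
  let ψ : ℝ × ℝ → ℂ := fun x => (χ x : ℂ)
  have hψ : Continuous ψ := Complex.continuous_ofReal.comp χ.continuous
  have hψc : HasCompactSupport ψ := χ.hasCompactSupport.comp_left Complex.ofReal_zero
  rw [eq_top_iff]
  intro g _
  obtain ⟨G, hG⟩ := ContinuousMap.exists_restrict_eq hKc.isClosed g
  let g' : ℝ × ℝ → ℂ := fun x => ψ x * G x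
  have hg' : Continuous g' := by fun_prop
  have hg'c : HasCompactSupport g' := hψc.mul_right
  have hψK : ∀ x : K, ψ x = 1 := fun x => by simp [ψ, hχ1 x]
  have hg'K : ∀ x : K, g' x = g x := fun x => by
    have : G x = g x := by rw [← hG]; rfl
    simp [g', hψK, this]
  rw [← SetLike.mem_coe, ← hB.closure_eq, Metric.mem_closure_iff]
  intro ε hε
  set η := min (1 / 9) (ε / (4 * (‖g‖ + 1))) with hη
  have hη0 : 0 < η := lt_min (by norm_num) (by positivity)
  obtain ⟨k, hk, hk1, hk2⟩ := ((eventually_gt_atTop (0 : ℝ)).and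
    ((norm_integral_exp_neg_mul_sqDiff_mul_sub_le hF₁c hF₂c hQ hψ hψc hη0).and
      (norm_integral_exp_neg_mul_sqDiff_mul_sub_le hF₁c hF₂c hQ hg' hg'c hη0))).exists
  obtain ⟨a, haB, ha⟩ := hT k ψ hψ hψc
  obtain ⟨b, hbB, hb⟩ := hT k g' hg' hg'c
  set c : K → ℂ := fun x => (k / Real.pi : ℝ) * ∫ y, Complex.exp (-k * sqDiff F₁ F₂ x y) with hc
  have hac : ∀ x, ‖a x - c x‖ ≤ η := fun x => by
    have := hk1 x
    rw [hψK, one_mul] at this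
    rw [ha]
    exact this
  have hbc : ∀ x, ‖b x - g x * c x‖ ≤ η := fun x => by
    have := hk2 x
    rw [hg'K] at this
    rw [hb]
    exact this
  have ha1 : ∀ x, ‖a x - 1‖ ≤ 1 / 2 := fun x => by
    have h1 := norm_integral_exp_neg_mul_sqDiff_sub_one_le hF₁c hF₂c hQ hk x
    calc ‖a x - 1‖ = ‖(a x - c x) + (c x - 1)‖ := by ring_nf
      _ ≤ 1 / 9 + 2 / 9 := norm_add_le_of_le ((hac x).trans (min_le_left _ _)) h1
      _ ≤ 1 / 2 := by norm_num
  have hahalf : ∀ x, 1 / 2 ≤ ‖a x‖ := fun x => by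
    have h1 := norm_sub_norm_le (1 : ℂ) (1 - a x)
    rw [norm_sub_rev 1 (a x), norm_one, sub_sub_cancel] at h1
    linarith [ha1 x]
  have ha0 : ∀ x, a x ≠ 0 := fun x h => by
    have := hahalf x
    rw [h, norm_zero] at this
    norm_num at this
  let ai : C(K, ℂ) := ⟨fun x => (a x)⁻¹, Continuous.inv₀ (by fun_prop) ha0⟩
  have haiB : ai ∈ B := ContinuousMap.one_add_inv_mem hB (B.sub_mem haB B.one_mem)
    (by simpa using ha1) (fun x => by simpa [ai] using inv_mul_cancel₀ (ha0 x))
  refine ⟨b * ai, B.mul_mem hbB haiB, ?_⟩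
  rw [ContinuousMap.dist_lt_iff hε]
  intro x
  rw [dist_eq_norm]
  have h1 : g x - (b * ai) x = (g x * (a x - c x) - (b x - g x * c x)) / a x := by
    have := ha0 x
    simp only [ContinuousMap.mul_apply, ai, ContinuousMap.coe_mk]
    field_simp
    ring
  rw [h1, norm_div, div_lt_iff₀ (norm_pos_iff.2 (ha0 x))]
  have hgx := g.norm_coe_le_norm x
  have hη2 : η * (4 * (‖g‖ + 1)) ≤ ε := by
    rw [← le_div_iff₀ (by positivity)]
    exact min_le_right _ _
  calc _ ≤ ‖g‖ * η + η := by
        refine (norm_sub_le _ _).trans (add_le_add ?_ (hbc x))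
        rw [norm_mul]
        gcongr
        exact hac x
    _ = η * (4 * (‖g‖ + 1)) / 4 := by ring
    _ ≤ ε / 4 := by gcongr
    _ < ε * (1 / 2) := by linarith
    _ ≤ ε * ‖a x‖ := by
        gcongr
        exact hahalf x

end Gaussian

end

section

open Filter Topology Asymptotics

section Taylor

variable {E F : Type*} [NormedAddCommGroup E] [NormedSpace ℝ E] [NormedAddCommGroup F]
  [NormedSpace ℝ F]

/-- Second-order Taylor formula at `0`, with a remainder controlled on pairs of points. -/
theorem ContDiff.exists_taylor_two {f : E → F} (hf : ContDiff ℝ 2 f) :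
    ∃ b : E →L[ℝ] E →L[ℝ] F, ∀ η > 0, ∀ᶠ ρ in 𝓝[>] (0 : ℝ), ∀ x y, ‖x‖ ≤ ρ → ‖y‖ ≤ ρ →
      ‖(f x - fderiv ℝ f 0 x - b x x) - (f y - fderiv ℝ f 0 y - b y y)‖ ≤ η * ρ * ‖x - y‖ := by
  set D2 := fderiv ℝ (fderiv ℝ f) 0 with hD2
  have hsymm : IsSymmSndFDerivAt ℝ f 0 := by
    apply hf.contDiffAt.isSymmSndFDerivAt
    simp
  have hd : DifferentiableAt ℝ (fderiv ℝ f) 0 :=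
    (hf.fderiv_right (m := 1) (by norm_num)).differentiable (by norm_num) 0
  have ho := hd.hasFDerivAt.isLittleO
  refine ⟨(1 / 2 : ℝ) • D2, fun η hη => ?_⟩
  have h1 := ho.def hη
  obtain ⟨r, hr, hball⟩ := Metric.eventually_nhds_iff.1 h1
  filter_upwards [Ioo_mem_nhdsGT hr] with ρ hρ x y hx hy
  refine (convex_closedBall (0 : E) ρ).norm_image_sub_le_of_norm_hasFDerivWithin_le
    (f := fun x => f x - fderiv ℝ f 0 x - ((1 / 2 : ℝ) • D2) x x)
    (f' := fun x => fderiv ℝ f x - fderiv ℝ f 0 - D2 x) ?_ ?_ (by simpa using hy)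
    (by simpa using hx)
  · intro z _
    have h2 : HasFDerivAt (fun x => ((1 / 2 : ℝ) • D2) x x) (D2 z) z := by
      have h4 := HasFDerivAt.comp (f := fun x : E => (x, x)) z
        (((1 / 2 : ℝ) • D2).isBoundedBilinearMap.hasFDerivAt (z, z))
        ((hasFDerivAt_id z).prodMk (hasFDerivAt_id z))
      refine h4.congr_fderiv ?_
      ext v
      have := hsymm v z
      simp only [← hD2] at this
      simp [this, ← add_smul]
      norm_num
    exact (((hf.differentiable (by norm_num) z).hasFDerivAt.sub
      (fderiv ℝ f 0).hasFDerivAt).sub h2).hasFDerivWithinAt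
  · intro z hz
    have hz' : ‖z‖ ≤ ρ := by simpa using hz
    have h5 := hball (y := z) (by simpa using hz'.trans_lt hρ.2)
    simp only [sub_zero] at h5
    exact h5.trans (by gcongr)

theorem ContDiff.exists_taylor_two_isLittleO {f : E → F} (hf : ContDiff ℝ 2 f) :
    ∃ b : E →L[ℝ] E →L[ℝ] F,
      (fun x => f x - f 0 - fderiv ℝ f 0 x - b x x) =o[𝓝 0] (fun x => ‖x‖ ^ 2) ∧
      ∀ η > 0, ∀ᶠ ρ in 𝓝[>] (0 : ℝ), ∀ x y, ‖x‖ ≤ ρ → ‖y‖ ≤ ρ →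
      ‖(f x - fderiv ℝ f 0 x - b x x) - (f y - fderiv ℝ f 0 y - b y y)‖ ≤ η * ρ * ‖x - y‖ := by
  obtain ⟨b, hb⟩ := hf.exists_taylor_two
  refine ⟨b, isLittleO_iff.2 fun η hη => ?_, hb⟩
  obtain ⟨r, hr, hball⟩ := mem_nhdsGT_iff_exists_Ioo_subset.1 (hb η hη)
  filter_upwards [Metric.ball_mem_nhds (0 : E) hr] with x hx
  rcases eq_or_ne x 0 with rfl | hx0
  · simp
  have := hball ⟨norm_pos_iff.2 hx0, by simpa using hx⟩ x 0 le_rfl (by simp)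
  simp only [map_zero, sub_zero] at this
  rw [norm_pow, norm_norm, pow_two, ← mul_assoc]
  convert this using 2
  abel

/-- A `C²` function that vanishes to order larger than two at `0` is small on pairs of points. -/
theorem ContDiff.norm_sub_le_of_isLittleO {f : E → F} (hf : ContDiff ℝ 2 f)
    (ho : f =o[𝓝 0] fun x => ‖x‖ ^ 2) {η : ℝ} (hη : 0 < η) : ∀ᶠ ρ in 𝓝[>] (0 : ℝ),
    ∀ x y, ‖x‖ ≤ ρ → ‖y‖ ≤ ρ → ‖f x - f y‖ ≤ η * ρ * ‖x - y‖ := by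
  obtain ⟨b, hb1, hb2⟩ := hf.exists_taylor_two_isLittleO
  have h0 : f 0 = 0 := by
    have := ho.isBigO.eq_zero_imp.self_of_nhds
    simpa using this
  have hd : fderiv ℝ f 0 = 0 := by
    apply HasFDerivAt.fderiv
    rw [hasFDerivAt_iff_isLittleO_nhds_zero]
    simp only [zero_add, h0, sub_zero, zero_apply]
    refine ho.trans_isBigO ?_
    refine IsBigO.of_bound 1 ?_
    filter_upwards [Metric.ball_mem_nhds (0 : E) one_pos] with x hx
    have : ‖x‖ < 1 := by simpa using hx
    rw [norm_pow, norm_norm]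
    nlinarith [norm_nonneg x]
  have hbz : ∀ x, b x x = 0 := by
    have h1 : (fun x => b x x) =o[𝓝 0] fun x : E => ‖x‖ ^ 2 := by
      have := ho.sub hb1
      simpa [h0, hd] using this
    intro x
    have h2 : Tendsto (fun t : ℝ => t • x) (𝓝[≠] 0) (𝓝 0) := by
      have : Tendsto (fun t : ℝ => t • x) (𝓝 0) (𝓝 ((0 : ℝ) • x)) :=
        (continuous_id.smul continuous_const).tendsto 0
      rw [zero_smul] at this
      exact this.mono_left nhdsWithin_le_nhds
    have h3 := h1.comp_tendsto h2
    by_contra hx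
    have h4 : (fun _ : ℝ => b x x) =o[𝓝[≠] 0] fun _ : ℝ => ‖x‖ ^ 2 := by
      rw [isLittleO_iff] at h3 ⊢
      intro c hc
      filter_upwards [h3 hc, self_mem_nhdsWithin] with t ht ht0
      have ht0 : 0 < |t| := abs_pos.2 ht0
      simp only [Function.comp_apply, map_smul, smul_apply, norm_smul,
        Real.norm_eq_abs, norm_pow, abs_mul, abs_abs, abs_norm] at ht ⊢
      have : 0 < |t| * |t| := by positivity
      nlinarith
    rw [isLittleO_const_const_iff] at h4
    exact hx h4
  filter_upwards [hb2 η hη] with ρ h x y hx hy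
  simpa [hd, hbz] using h x y hx hy

end Taylor

section Sqrt

theorem Complex.norm_sqrt_one_add_sub_one_le {z : ℂ} (hz : ‖z‖ < 1) :
    ‖(1 + z) ^ (1 / 2 : ℂ) - 1‖ ≤ ‖z‖ := by
  have h1 := Complex.re_sqrt_pos (Complex.one_add_mem_slitPlane hz)
  have h2 := Complex.sqrt_sq (1 + z)
  set w := (1 + z) ^ (1 / 2 : ℂ)
  have h3 : (w - 1) * (w + 1) = z := by linear_combination h2
  have h4 : 1 ≤ ‖w + 1‖ := by
    have := Complex.re_le_norm (w + 1)
    simp only [Complex.add_re, Complex.one_re] at this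
    linarith
  rw [← h3, norm_mul]
  exact le_mul_of_one_le_right (norm_nonneg _) h4

variable {G : Type*} [NormedAddCommGroup G]

/-- A branch of the square root of `ℓ² + e`, where `ℓ` is bi-Lipschitz and `e` is of higher order,
is a perturbation of `ℓ` with arbitrarily small Lipschitz constant near the origin. -/
theorem exists_sq_eq_sq_add {ℓ e : G → ℂ} {c C : ℝ} (hc : 0 < c) (hC : 0 < C) (hℓ0 : ∀ x, c * ‖x‖ ≤
    ‖ℓ x‖)
    (hℓ : ∀ x y, ‖ℓ x - ℓ y‖ ≤ C * ‖x - y‖) (he0 : e 0 = 0) (hl0 : ℓ 0 = 0)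
    (he : ∀ η > 0, ∀ᶠ ρ in 𝓝[>] (0 : ℝ), ∀ x y, ‖x‖ ≤ ρ → ‖y‖ ≤ ρ →
      ‖e x - e y‖ ≤ η * ρ * ‖x - y‖) :
    ∃ V : G → ℂ, V 0 = 0 ∧ (∀ x, V x ^ 2 = ℓ x ^ 2 + e x) ∧
      ∀ η > 0, ∀ᶠ ρ in 𝓝[>] (0 : ℝ), ∀ x y, ‖x‖ ≤ ρ → ‖y‖ ≤ ρ →
        ‖(V x - ℓ x) - (V y - ℓ y)‖ ≤ η * ‖x - y‖ := by
  have hev (κ : ℝ) (hκ : 0 < κ) : ∃ r > 0, ∀ x y, ‖x‖ < r → ‖y‖ ≤ ‖x‖ →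
      ‖e x - e y‖ ≤ κ * ‖x‖ * ‖x - y‖ := by
    obtain ⟨r, hr, hball⟩ := mem_nhdsGT_iff_exists_Ioo_subset.1 (he κ hκ)
    refine ⟨r, hr, fun x y hx hy => ?_⟩
    rcases eq_or_ne x 0 with rfl | hx0
    · have : y = 0 := by simpa using hy
      simp [this]
    exact hball ⟨norm_pos_iff.2 hx0, hx⟩ x y le_rfl hy
  set V : G → ℂ := fun x => ℓ x * (1 + e x / ℓ x ^ 2) ^ (1 / 2 : ℂ) with hV
  have hlne {x : G} (hx : x ≠ 0) : ℓ x ≠ 0 := by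
    intro h
    have := hℓ0 x
    rw [h, norm_zero] at this
    have := mul_pos hc (norm_pos_iff.2 hx)
    linarith
  have hVsq {x : G} : V x ^ 2 = ℓ x ^ 2 + e x := by
    rcases eq_or_ne x 0 with rfl | hx0
    · simp [hV, hl0, he0]
    · rw [hV]
      simp only
      rw [mul_pow, Complex.sqrt_sq]
      have := hlne hx0
      field_simp
  have hVl (κ : ℝ) (hκ : 0 < κ) (hκ' : κ < c ^ 2) {r : ℝ} (hr : ∀ x y, ‖x‖ < r → ‖y‖ ≤ ‖x‖ →
      ‖e x - e y‖ ≤ κ * ‖x‖ * ‖x - y‖) (x : G) (hx : ‖x‖ < r) : ‖V x - ℓ x‖ ≤ κ / c * ‖x‖ := by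
    rcases eq_or_ne x 0 with rfl | hx0
    · simp [hV, hl0]
    have hxp := norm_pos_iff.2 hx0
    have h1 : ‖e x‖ ≤ κ * ‖x‖ * ‖x‖ := by simpa [he0] using hr x 0 hx (by simp)
    have hlp : 0 < ‖ℓ x‖ := norm_pos_iff.2 (hlne hx0)
    have hlx := hℓ0 x
    have h2 : ‖e x / ℓ x ^ 2‖ < 1 := by
      rw [norm_div, norm_pow, div_lt_one (by positivity)]
      have : (c * ‖x‖) ^ 2 ≤ ‖ℓ x‖ ^ 2 := by gcongr
      nlinarith [mul_pos hxp hxp]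
    have h3 := Complex.norm_sqrt_one_add_sub_one_le h2
    have h4 : V x - ℓ x = ℓ x * ((1 + e x / ℓ x ^ 2) ^ (1 / 2 : ℂ) - 1) := by
      simp only [hV]; ring
    rw [h4, norm_mul]
    calc ‖ℓ x‖ * ‖(1 + e x / ℓ x ^ 2) ^ (1 / 2 : ℂ) - 1‖ ≤ ‖ℓ x‖ * ‖e x / ℓ x ^ 2‖ := by gcongr
      _ = ‖e x‖ / ‖ℓ x‖ := by rw [norm_div, norm_pow]; field_simp
      _ ≤ (κ * ‖x‖ * ‖x‖) / (c * ‖x‖) := by gcongr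
      _ = κ / c * ‖x‖ := by field_simp
  refine ⟨V, by simp [hV, hl0], fun x => hVsq, fun η hη => ?_⟩
  set θ := c / (2 * C) with hθ
  have hθp : 0 < θ := by positivity
  obtain ⟨κ, hκ, hκ1, hκ2, hκ3, hκ4⟩ : ∃ κ > 0, κ < c ^ 2 ∧ 2 * (κ / c) ≤ c / 2 ∧
      2 * (κ / c) ≤ η * θ ∧ (C * (2 * (κ / c)) + κ) ≤ η * c := by
    have ht (f : ℝ → ℝ) (hf : Continuous f) (h0 : f 0 = 0) (b : ℝ) (hb : 0 < b) :
        ∀ᶠ κ in 𝓝[>] (0 : ℝ), f κ < b :=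
      (hf.tendsto 0).mono_left nhdsWithin_le_nhds |>.eventually_lt_const (by rwa [h0])
    obtain ⟨κ, h1, h2, h3, h4, h5⟩ := (Eventually.and (f := 𝓝[>] (0 : ℝ)) self_mem_nhdsWithin
     
      ((ht id continuous_id rfl (c ^ 2) (by positivity)).and
      ((ht (fun κ => 2 * (κ / c)) (by fun_prop) (by simp) (c / 2) (by positivity)).and
      ((ht (fun κ => 2 * (κ / c)) (by fun_prop) (by simp) (η * θ) (by positivity)).and
      (ht (fun κ => C * (2 * (κ / c)) + κ) (by fun_prop) (by simp) (η * c)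
        (by positivity)))))).exists
    exact ⟨κ, h1, h2, h3.le, h4.le, h5.le⟩
  obtain ⟨r, hr, hball⟩ := hev κ hκ
  have hVl' := hVl κ hκ hκ1 hball
  have key (x y : G) (hx : ‖x‖ < r) (hyx : ‖y‖ ≤ ‖x‖) :
      ‖(V x - ℓ x) - (V y - ℓ y)‖ ≤ η * ‖x - y‖ := by
    have h1 := hVl' x hx
    have h2 : ‖V y - ℓ y‖ ≤ κ / c * ‖x‖ := (hVl' y (hyx.trans_lt hx)).trans (by gcongr)
    rcases le_total (θ * ‖x‖) ‖x - y‖ with h | h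
    · calc ‖(V x - ℓ x) - (V y - ℓ y)‖ ≤ κ / c * ‖x‖ + κ / c * ‖x‖ :=
            (norm_sub_le _ _).trans (add_le_add h1 h2)
        _ = 2 * (κ / c) * ‖x‖ := by ring
        _ ≤ η * θ * ‖x‖ := by gcongr
        _ ≤ η * ‖x - y‖ := by rw [mul_assoc]; gcongr
    · rcases eq_or_ne x 0 with rfl | hx0
      · have : y = 0 := by simpa using hyx
        simp [this]
      have hxp := norm_pos_iff.2 hx0
      have h3 : c * ‖x‖ ≤ ‖V x + V y‖ := by
        have e1 : 2 * ℓ x = (V x + V y) + (ℓ x - ℓ y) - (V x - ℓ x) - (V y - ℓ y) := by ring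
        have e2 : ‖2 * ℓ x‖ ≤ ‖V x + V y‖ + ‖ℓ x - ℓ y‖ + ‖V x - ℓ x‖ + ‖V y - ℓ y‖ := by
          rw [e1]
          refine (norm_sub_le _ _).trans (add_le_add_left ?_ _)
          exact (norm_sub_le _ _).trans (add_le_add_left (norm_add_le _ _) _)
        rw [norm_mul, Complex.norm_ofNat] at e2
        have e3 := hℓ x y
        have e4 : C * ‖x - y‖ ≤ c / 2 * ‖x‖ := by
          calc C * ‖x - y‖ ≤ C * (θ * ‖x‖) := by gcongr
            _ = c / 2 * ‖x‖ := by rw [hθ]; field_simp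
        have e5 : 2 * (κ / c) * ‖x‖ ≤ c / 2 * ‖x‖ := by gcongr
        have := hℓ0 x
        linarith
      have h4 : ((V x - ℓ x) - (V y - ℓ y)) * (V x + V y) =
          (e x - e y) - (ℓ x - ℓ y) * ((V x - ℓ x) + (V y - ℓ y)) := by
        linear_combination hVsq (x := x) - hVsq (x := y)
      have h5 : ‖(V x - ℓ x) - (V y - ℓ y)‖ * (c * ‖x‖) ≤ η * ‖x - y‖ * (c * ‖x‖) := by
        calc ‖(V x - ℓ x) - (V y - ℓ y)‖ * (c * ‖x‖)
            ≤ ‖(V x - ℓ x) - (V y - ℓ y)‖ * ‖V x + V y‖ := by gcongr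
          _ = ‖(e x - e y) - (ℓ x - ℓ y) * ((V x - ℓ x) + (V y - ℓ y))‖ := by rw [← norm_mul, h4]
          _ ≤ κ * ‖x‖ * ‖x - y‖ + (C * ‖x - y‖) * (κ / c * ‖x‖ + κ / c * ‖x‖) := by
              refine (norm_sub_le _ _).trans (add_le_add (hball x y hx hyx) ?_)
              rw [norm_mul]
              gcongr
              · exact hℓ x y
              · exact (norm_add_le _ _).trans (add_le_add h1 h2)
          _ = (C * (2 * (κ / c)) + κ) * (‖x‖ * ‖x - y‖) := by ring
          _ ≤ (η * c) * (‖x‖ * ‖x - y‖) := by gcongr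
          _ = _ := by ring
      exact le_of_mul_le_mul_right h5 (by positivity)
  filter_upwards [Ioo_mem_nhdsGT hr] with ρ hρ x y hx hy
  rcases le_total ‖y‖ ‖x‖ with h | h
  · exact key x y (hx.trans_lt hρ.2) h
  · rw [norm_sub_rev, norm_sub_rev x y]
    exact key y x (hy.trans_lt hρ.2) h

end Sqrt

section Umbrella

theorem exists_mul_sq_le_quadratic {α β γ : ℝ} (hα : 0 < α) (hD : 0 < 4 * α * γ - β ^ 2) :
    ∃ k > 0, ∀ s τ : ℝ, 0 ≤ τ → k * (|s| + τ) ^ 2 ≤ α * s ^ 2 + β * (s * τ) + γ * τ ^ 2 := by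
  have hγ : 0 < γ := by
    by_contra! h
    nlinarith [sq_nonneg β, mul_nonneg hα.le (neg_nonneg.2 h)]
  set D := 4 * α * γ - β ^ 2 with hDd
  refine ⟨D / (8 * (α + γ)), by positivity, fun s τ hτ => ?_⟩
  rw [div_mul_eq_mul_div, div_le_iff₀ (by positivity)]
  have h1 : D * (|s| + τ) ^ 2 ≤ D * (2 * (s ^ 2 + τ ^ 2)) := by
    gcongr
    nlinarith [sq_nonneg (|s| - τ), sq_abs s]
  nlinarith [sq_nonneg (2 * α * s + β * τ), sq_nonneg (2 * γ * τ + β * s)]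

/-- The weight of a point `(t, s)` for which `t` has weight one half and `s` has weight one. -/
def umbrellaWeight (x : ℝ × ℝ) : ℝ := |x.2| + x.1 ^ 2

theorem umbrellaWeight_nonneg (x : ℝ × ℝ) : 0 ≤ umbrellaWeight x := by
  unfold umbrellaWeight
  positivity

theorem umbrellaWeight_pos {x : ℝ × ℝ} (hx : x ≠ 0) : 0 < umbrellaWeight x := by
  refine (umbrellaWeight_nonneg x).lt_of_ne fun h => hx ?_
  have h1 : |x.2| = 0 := by
    unfold umbrellaWeight at h
    nlinarith [abs_nonneg x.2, sq_nonneg x.1]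
  have h2 : x.1 ^ 2 = 0 := by
    unfold umbrellaWeight at h
    linarith
  exact Prod.ext (pow_eq_zero_iff two_ne_zero |>.1 h2) (abs_eq_zero.1 h1)

theorem isBigO_fst_norm : (fun x : ℝ × ℝ => (x.1 : ℂ)) =O[𝓝 0] fun x => ‖x‖ :=
  IsBigO.of_bound 1 (Eventually.of_forall fun x => by simpa using norm_fst_le x)

theorem isBigO_sq_fst_umbrellaWeight :
    (fun x : ℝ × ℝ => (x.1 : ℂ) ^ 2) =O[𝓝 0] umbrellaWeight :=
  IsBigO.of_bound 1 (Eventually.of_forall fun x => by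
    rw [Real.norm_of_nonneg (umbrellaWeight_nonneg x), umbrellaWeight]
    simp)

theorem isBigO_snd_umbrellaWeight : (fun x : ℝ × ℝ => (x.2 : ℂ)) =O[𝓝 0] umbrellaWeight :=
  IsBigO.of_bound 1 (Eventually.of_forall fun x => by
    rw [Real.norm_of_nonneg (umbrellaWeight_nonneg x), umbrellaWeight]
    simp [sq_nonneg])

theorem isBigO_umbrellaWeight_norm : umbrellaWeight =O[𝓝 0] fun x => ‖x‖ := by
  refine IsBigO.of_bound 2 ?_
  filter_upwards [Metric.ball_mem_nhds (0 : ℝ × ℝ) one_pos] with x hx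
  have hx : ‖x‖ < 1 := by simpa using hx
  have h1 := norm_fst_le x
  have h2 := norm_snd_le x
  rw [Real.norm_eq_abs] at h1 h2
  rw [Real.norm_of_nonneg (umbrellaWeight_nonneg x), umbrellaWeight, norm_norm, ← sq_abs]
  nlinarith [abs_nonneg x.1, norm_nonneg x]

theorem isLittleO_norm_one : (fun x : ℝ × ℝ => ‖x‖) =o[𝓝 0] fun _ => (1 : ℝ) := by
  rw [isLittleO_one_iff]
  exact continuous_norm.tendsto' _ _ norm_zero

variable {zf wf : ℝ × ℝ → ℂ} {X₁ X₂ U₁ U₂ m : ℂ}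

theorem isBigO_sub_snd
    (hw1 : (fun x => wf x - (x.2 + x.1 * x.2 * X₂ + 2 / 3 * x.1 ^ 3 * U₂)) =O[𝓝 0]
      fun x => umbrellaWeight x ^ 2) :
    (fun x => wf x - x.2) =O[𝓝 0] fun x => ‖x‖ * umbrellaWeight x := by
  have h1 : (fun x => umbrellaWeight x ^ 2) =O[𝓝 0] fun x => ‖x‖ * umbrellaWeight x := by
    simpa only [pow_two] using isBigO_umbrellaWeight_norm.mul (isBigO_refl umbrellaWeight (𝓝 0))
  have h2 := (isBigO_fst_norm.mul isBigO_snd_umbrellaWeight).const_mul_left X₂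
  have h3 := (isBigO_fst_norm.mul isBigO_sq_fst_umbrellaWeight).const_mul_left (2 / 3 * U₂)
  refine (((hw1.trans h1).add h2).add h3).congr_left fun x => ?_
  ring

theorem norm_sub_sub_snd_le (hw : ContDiff ℝ 2 wf)
    (hw1 : (fun x => wf x - (x.2 + x.1 * x.2 * X₂ + 2 / 3 * x.1 ^ 3 * U₂)) =O[𝓝 0]
      fun x => umbrellaWeight x ^ 2) {η : ℝ} (hη : 0 < η) :
    ∀ᶠ ρ in 𝓝[>] (0 : ℝ), ∀ x y, ‖x‖ ≤ ρ → ‖y‖ ≤ ρ →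
      ‖(wf x - x.2) - (wf y - y.2)‖ ≤ η * ‖x - y‖ := by
  have ho : (fun x => wf x - x.2) =o[𝓝 0] fun x => ‖x‖ := by
    refine (isBigO_sub_snd hw1).trans_isLittleO ?_
    simpa using (isBigO_refl (fun x : ℝ × ℝ => ‖x‖) (𝓝 0)).mul_isLittleO
      (isBigO_umbrellaWeight_norm.trans_isLittleO isLittleO_norm_one)
  have h0 : wf 0 = 0 := by
    have := ho.isBigO.eq_zero_imp.self_of_nhds
    simpa using this
  have hd : HasStrictFDerivAt (fun x : ℝ × ℝ => wf x - x.2) (0 : ℝ × ℝ →L[ℝ] ℂ) 0 := by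
    have hc : ContDiff ℝ 2 (fun x : ℝ × ℝ => wf x - x.2) :=
      hw.sub (Complex.ofRealCLM.contDiff.comp contDiff_snd)
    refine hc.contDiffAt.hasStrictFDerivAt' ?_ (by norm_num)
    rw [hasFDerivAt_iff_isLittleO_nhds_zero]
    simpa [h0] using ho.of_norm_right
  have h1 := hd.isLittleO.def hη
  rw [show ((0 : ℝ × ℝ), (0 : ℝ × ℝ)) = 0 from rfl] at h1
  obtain ⟨r, hr, hball⟩ := Metric.eventually_nhds_iff.1 h1
  filter_upwards [Ioo_mem_nhdsGT hr] with ρ hρ x y hx hy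
  simpa using hball (y := (x, y)) (by
    rw [dist_zero_right, Prod.norm_def]
    exact (max_le hx hy).trans_lt hρ.2)

/-- A suitable quadratic polynomial in `(zf, wf)` has a square root `V` that is a small Lipschitz
perturbation of a linear function, and the argument of `V * (wf + a * zf)` is controlled. -/
theorem exists_sqrt_of_umbrella {n₁₁ n₁₂ n₂₂ : ℝ} (hz : ContDiff ℝ 2 zf) (hw : ContDiff ℝ 2 wf)
    (hz2 : (fun x => zf x - (x.1 ^ 2 + x.1 * x.2 * X₁ + 2 / 3 * x.1 ^ 3 * U₁ + m * x.2 ^ 2))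
      =o[𝓝 0] fun x => ‖x‖ * umbrellaWeight x)
    (hz1 : (fun x => zf x - (x.1 ^ 2 + x.1 * x.2 * X₁ + 2 / 3 * x.1 ^ 3 * U₁)) =O[𝓝 0]
      fun x => umbrellaWeight x ^ 2)
    (hw1 : (fun x => wf x - (x.2 + x.1 * x.2 * X₂ + 2 / 3 * x.1 ^ 3 * U₂)) =O[𝓝 0]
      fun x => umbrellaWeight x ^ 2)
    (hX₁ : X₁.im = -n₁₁) (hX₂ : X₂.im = -n₁₂) (hU₁ : U₁.im = -n₁₂) (hU₂ : U₂.im = -n₂₂)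
    (hn : 0 < n₁₁) (hdet : 0 < n₁₁ * n₂₂ - n₁₂ ^ 2) :
    ∃ (q a : ℂ) (V : ℝ × ℝ → ℂ), V 0 = 0 ∧ (∀ x, V x ^ 2 = zf x + q * wf x ^ 2) ∧
      (∀ᶠ x in 𝓝 0, x ≠ 0 → (V x * (wf x + a * zf x)).im < 0) ∧
      ∀ η > 0, ∀ᶠ ρ in 𝓝[>] (0 : ℝ), ∀ x y, ‖x‖ ≤ ρ → ‖y‖ ≤ ρ →
        ‖(V x - (x.1 + X₁ / 2 * x.2)) - (V y - (y.1 + X₁ / 2 * y.2))‖ ≤ η * ‖x - y‖ := by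
  set q : ℂ := X₁ ^ 2 / 4 - m with hq
  set a : ℝ := -(4 / 9) * n₁₂ / n₁₁ with ha
  set N := umbrellaWeight with hN
  set ℓ : ℝ × ℝ → ℂ := fun x => x.1 + X₁ / 2 * x.2 with hℓ
  set V₁ : ℝ × ℝ → ℂ := fun x => ℓ x + U₁ / 3 * x.1 ^ 2 with hV₁
  set w₁ : ℝ × ℝ → ℂ := fun x => x.2 + a * x.1 ^ 2 +
    x.1 * ((X₂ + a * X₁) * x.2 + 2 / 3 * (U₂ + a * U₁) * x.1 ^ 2) with hw₁
  have hr : (fun x : ℝ × ℝ => ‖x‖) =O[𝓝 0] fun x => ‖x‖ := isBigO_refl _ _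
  have hNN : N =O[𝓝 0] N := isBigO_refl _ _
  have ht : (fun x : ℝ × ℝ => (x.1 : ℂ)) =O[𝓝 0] fun x => ‖x‖ := isBigO_fst_norm
  have ht2 : (fun x : ℝ × ℝ => (x.1 : ℂ) ^ 2) =O[𝓝 0] N := isBigO_sq_fst_umbrellaWeight
  have hs : (fun x : ℝ × ℝ => (x.2 : ℂ)) =O[𝓝 0] N := isBigO_snd_umbrellaWeight
  have hNr : N =O[𝓝 0] fun x => ‖x‖ := isBigO_umbrellaWeight_norm
  have hr1 : (fun x : ℝ × ℝ => ‖x‖) =o[𝓝 0] fun _ => (1 : ℝ) := isLittleO_norm_one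
  have hws := isBigO_sub_snd hw1
  have hrN : (fun x : ℝ × ℝ => ‖x‖ * N x) =O[𝓝 0] N := by
    simpa using hr1.isBigO.mul hNN
  have hrrN : (fun x : ℝ × ℝ => ‖x‖ * (‖x‖ * N x)) =o[𝓝 0] fun x => ‖x‖ * N x := by
    simpa using hr1.mul_isBigO (isBigO_refl (fun x : ℝ × ℝ => ‖x‖ * N x) (𝓝 0))
  have hw2 : (fun x => wf x ^ 2 - x.2 ^ 2) =o[𝓝 0] fun x => ‖x‖ * N x := by
    have h1 : (fun x => wf x + x.2) =O[𝓝 0] fun x => ‖x‖ := by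
      refine (((hws.trans hrN).add (hs.const_mul_left 2)).trans hNr).congr_left fun x => ?_
      ring
    refine ((h1.mul hws).trans_isLittleO hrrN).congr_left fun x => ?_
    ring
  have hR : (fun x => zf x + q * wf x ^ 2 - V₁ x ^ 2) =o[𝓝 0] fun x => ‖x‖ * N x := by
    have h1 := ((ht.mul (ht.mul hs)).trans_isLittleO hrrN).const_mul_left (1 / 3 * U₁ * X₁)
    have h2 := ((ht.mul (ht.mul ht2)).trans_isLittleO hrrN).const_mul_left (U₁ ^ 2 / 9)
    refine (((hz2.add (hw2.const_mul_left q)).sub h1).sub h2).congr_left fun x => ?_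
    simp only [hV₁, hℓ, hq]
    ring
  have hℓr : ℓ =O[𝓝 0] fun x => ‖x‖ := ht.add ((hs.trans hNr).const_mul_left _)
  have hee : (fun x => zf x + q * wf x ^ 2 - ℓ x ^ 2) =o[𝓝 0] fun x => ‖x‖ ^ 2 := by
    have h1 : (fun x : ℝ × ℝ => ‖x‖ * N x) =O[𝓝 0] fun x => ‖x‖ ^ 2 := by
      simpa only [pow_two] using hr.mul hNr
    have h3 : ((fun x : ℝ × ℝ => (x.1 : ℂ) * (x.1 * ℓ x))) =o[𝓝 0] fun x => ‖x‖ ^ 2 := by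
      simpa [pow_two] using (ht.trans_isLittleO hr1).mul_isBigO (ht.mul hℓr)
    have h4 : ((fun x : ℝ × ℝ => (x.1 : ℂ) * (x.1 * x.1 ^ 2))) =o[𝓝 0] fun x => ‖x‖ ^ 2 := by
      simpa [pow_two] using (ht.trans_isLittleO hr1).mul_isBigO (ht.mul (ht2.trans hNr))
    refine (((hR.trans_isBigO h1).add (h3.const_mul_left (2 * (U₁ / 3)))).add
      (h4.const_mul_left ((U₁ / 3) ^ 2))).congr_left fun x => ?_
    simp only [hV₁]
    ring
  have hX : 0 < |X₁.im| := by rw [hX₁, abs_neg]; exact abs_pos.2 hn.ne'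
  set c : ℝ := 2 / |X₁.im| + 1 + ‖X₁‖ / |X₁.im| with hc
  have hcp : 0 < c := by positivity
  have hℓc (x : ℝ × ℝ) : c⁻¹ * ‖x‖ ≤ ‖ℓ x‖ := by
    rw [inv_mul_le_iff₀ hcp]
    have h1 : |x.2| ≤ 2 / |X₁.im| * ‖ℓ x‖ := by
      have := Complex.abs_im_le_norm (ℓ x)
      have h2 : (ℓ x).im = X₁.im / 2 * x.2 := by
        simp [hℓ]
      rw [h2, abs_mul, abs_div] at this
      rw [div_mul_eq_mul_div, le_div_iff₀ hX]
      simp only [Nat.abs_ofNat] at this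
      linarith
    have h2 : |x.1| ≤ (1 + ‖X₁‖ / |X₁.im|) * ‖ℓ x‖ := by
      have : (x.1 : ℂ) = ℓ x - X₁ / 2 * x.2 := by simp [hℓ]
      have h3 : |x.1| ≤ ‖ℓ x‖ + ‖X₁‖ / 2 * |x.2| := by
        rw [← Real.norm_eq_abs, ← Complex.norm_real, this]
        refine (norm_sub_le _ _).trans ?_
        simp
      calc |x.1| ≤ ‖ℓ x‖ + ‖X₁‖ / 2 * (2 / |X₁.im| * ‖ℓ x‖) := h3.trans (by gcongr)
        _ = _ := by ring
    rw [Prod.norm_def, Real.norm_eq_abs, Real.norm_eq_abs]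
    refine max_le (h2.trans ?_) (h1.trans ?_) <;> gcongr <;> rw [hc]
    · have : 0 < 2 / |X₁.im| := by positivity
      linarith
    · have : 0 ≤ ‖X₁‖ / |X₁.im| := by positivity
      linarith
  have hℓC (x y : ℝ × ℝ) : ‖ℓ x - ℓ y‖ ≤ (1 + ‖X₁‖ / 2) * ‖x - y‖ := by
    have h1 : ℓ x - ℓ y = ((x - y).1 : ℝ) + X₁ / 2 * ((x - y).2 : ℝ) := by
      simp [hℓ]; ring
    rw [h1, add_mul, one_mul]
    refine (norm_add_le _ _).trans (add_le_add ?_ ?_)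
    · simpa only [Complex.norm_real] using norm_fst_le (x - y)
    · rw [norm_mul, Complex.norm_real, norm_div, Complex.norm_ofNat]
      gcongr
      exact norm_snd_le (x - y)
  have hcd : ContDiff ℝ 2 (fun x => zf x + q * wf x ^ 2 - ℓ x ^ 2) := by
    have h1 : ContDiff ℝ 2 (fun x : ℝ × ℝ => (x.1 : ℂ)) := Complex.ofRealCLM.contDiff.comp
        contDiff_fst
    have h2 : ContDiff ℝ 2 (fun x : ℝ × ℝ => (x.2 : ℂ)) := Complex.ofRealCLM.contDiff.comp
        contDiff_snd
    simp only [hℓ]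
    fun_prop
  obtain ⟨V, hV0, hVsq, hVℓ⟩ := exists_sq_eq_sq_add (inv_pos.2 hcp) (by positivity) hℓc hℓC
    (by simpa using hee.isBigO.eq_zero_imp.self_of_nhds) (by simp [hℓ])
    fun η hη => hcd.norm_sub_le_of_isLittleO hee hη
  have hVr : (fun x => V x - ℓ x) =o[𝓝 0] fun x => ‖x‖ := by
    refine isLittleO_iff.2 fun η hη => ?_
    obtain ⟨r, hr, hball⟩ := mem_nhdsGT_iff_exists_Ioo_subset.1 (hVℓ η hη)
    filter_upwards [Metric.ball_mem_nhds (0 : ℝ × ℝ) hr] with x hx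
    rcases eq_or_ne x 0 with rfl | hx0
    · simp [hV0, hℓ]
    have := hball ⟨norm_pos_iff.2 hx0, by simpa using hx⟩ x 0 le_rfl (by simp)
    simpa [hV0, hℓ] using this
  have hVO : V =O[𝓝 0] fun x => ‖x‖ := (hVr.isBigO.add hℓr).congr_left fun x => by ring
  have hδ : (fun x => V x - V₁ x) =o[𝓝 0] N := by
    have h1 : (fun x => ‖x‖) =O[𝓝 0] fun x => V x + V₁ x := by
      have h2 : (fun x => ‖x‖) =O[𝓝 0] fun x => 2 * ℓ x := by
        refine IsBigO.of_bound c (Eventually.of_forall fun x => ?_)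
        have := (inv_mul_le_iff₀ hcp).1 (hℓc x)
        rw [norm_norm, norm_mul, Complex.norm_ofNat]
        nlinarith [norm_nonneg (ℓ x)]
      have h3 : (fun x : ℝ × ℝ => (U₁ / 3) * ((x.1 : ℂ) * x.1)) =o[𝓝 0] fun x => ‖x‖ := by
        simpa using ((ht.trans_isLittleO hr1).mul_isBigO ht).const_mul_left (U₁ / 3)
      have h4 := ((hVr.add h3).trans_isBigO h2).right_isTheta_add.isBigO
      refine h2.trans (h4.congr_right fun x => ?_)
      simp only [hV₁, Pi.add_apply]
      ring
    have h5 : (fun x => ‖x‖ * ‖V x - V₁ x‖) =o[𝓝 0] fun x => ‖x‖ * N x := by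
      have h6 := h1.mul (isBigO_refl (fun x => V x - V₁ x) (𝓝 0)).norm_left
      refine h6.trans_isLittleO (hR.congr_left fun x => ?_)
      linear_combination -hVsq x
    rw [isLittleO_iff] at h5 ⊢
    intro η hη
    filter_upwards [h5 hη] with x hx
    rcases eq_or_ne x 0 with rfl | hx0
    · simpa [hV0, hV₁, hℓ] using mul_nonneg hη.le (abs_nonneg _)
    have hxp := norm_pos_iff.2 hx0
    rw [norm_mul, norm_mul, norm_norm, norm_norm] at hx
    refine le_of_mul_le_mul_left ?_ hxp
    linarith
  have hN2 : (fun x => ‖x‖ * (N x * N x)) =o[𝓝 0] fun x => N x * N x := by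
    simpa using hr1.mul_isBigO (hNN.mul hNN)
  have hw₁N : w₁ =O[𝓝 0] N := by
    have h1 : (fun x : ℝ × ℝ => (X₂ + a * X₁) * (x.2 : ℂ) +
        2 / 3 * (U₂ + a * U₁) * x.1 ^ 2) =O[𝓝 0] N :=
      (hs.const_mul_left _).add (ht2.const_mul_left _)
    exact (hs.add (ht2.const_mul_left _)).add ((ht.mul h1).trans hrN)
  have hVw : (fun x => V x * (wf x + a * zf x) - V₁ x * w₁ x) =o[𝓝 0] fun x => N x * N x := by
    have h1 : (fun x => wf x + a * zf x - w₁ x) =O[𝓝 0] fun x => N x * N x := by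
      simp only [pow_two] at hw1 hz1
      refine (hw1.add (hz1.const_mul_left (a : ℂ))).congr_left fun x => ?_
      simp only [hw₁]
      ring
    refine ((hδ.mul_isBigO hw₁N).add ((hVO.mul h1).trans_isLittleO hN2)).congr_left fun x => ?_
    ring
  set β : ℝ := 2 / 3 * n₁₂ with hβ
  set γ : ℝ := 2 / 3 * n₂₂ + a * n₁₂ with hγ
  have han : a * n₁₁ = -(4 / 9) * n₁₂ := by
    rw [ha]
    field_simp
  obtain ⟨k, hk, hquad⟩ := exists_mul_sq_le_quadratic (α := n₁₁ / 2) (β := β) (γ := γ)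
    (by positivity) (by rw [hγ, hβ]; linear_combination (4 / 3 : ℝ) * hdet - 2 * n₁₂ * han)
  have hVw₁ : (fun x : ℝ × ℝ => (((V₁ x * w₁ x).im + (n₁₁ / 2 * x.2 ^ 2 + β * (x.2 * x.1 ^ 2) +
      γ * (x.1 ^ 2) ^ 2) : ℝ) : ℂ)) =o[𝓝 0] fun x => N x * N x := by
    have h1 (A B : ℝ) : (fun x : ℝ × ℝ => (A : ℂ) * x.2 + B * x.1 ^ 2) =O[𝓝 0] N :=
      (hs.const_mul_left _).add (ht2.const_mul_left _)
    have h2 (A B C D : ℝ) : (fun x : ℝ × ℝ => (x.1 : ℂ) * (((A : ℂ) * x.2 + B * x.1 ^ 2) *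
        ((C : ℂ) * x.2 + D * x.1 ^ 2))) =o[𝓝 0] fun x => N x * N x :=
      (ht.mul ((h1 A B).mul (h1 C D))).trans_isLittleO hN2
    have h3 := (h2 (-n₁₁ / 2) (-n₁₂ / 3) (X₂.re + a * X₁.re) (2 / 3 * (U₂.re + a * U₁.re))).add
      (h2 (X₁.re / 2) (U₁.re / 3) (X₂.im + a * X₁.im) (2 / 3 * (U₂.im + a * U₁.im)))
    refine h3.congr_left fun x => ?_
    have e1 : (V₁ x).re = x.1 + (X₁.re / 2 * x.2 + U₁.re / 3 * x.1 ^ 2) := by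
      simp [hV₁, hℓ, ← Complex.ofReal_pow]; ring
    have e2 : (V₁ x).im = X₁.im / 2 * x.2 + U₁.im / 3 * x.1 ^ 2 := by
      simp [hV₁, hℓ, ← Complex.ofReal_pow]
    have e3 : (w₁ x).re = x.2 + a * x.1 ^ 2 +
        x.1 * ((X₂.re + a * X₁.re) * x.2 + 2 / 3 * (U₂.re + a * U₁.re) * x.1 ^ 2) := by
      simp [hw₁, ← Complex.ofReal_pow]
    have e4 : (w₁ x).im =
        x.1 * ((X₂.im + a * X₁.im) * x.2 + 2 / 3 * (U₂.im + a * U₁.im) * x.1 ^ 2) := by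
      simp [hw₁, ← Complex.ofReal_pow]
    rw [Complex.mul_im, e1, e2, e3, e4, hX₁, hX₂, hU₁, hU₂, hβ, hγ]
    norm_cast
    linear_combination (3 / 2 : ℝ) * x.1 ^ 2 * x.2 * han
  have hfin := (hVw.def (half_pos (half_pos hk))).and (hVw₁.def (half_pos (half_pos hk)))
  refine ⟨q, a, V, hV0, fun x => by rw [hVsq]; ring, ?_, hVℓ⟩
  filter_upwards [hfin] with x ⟨h1, h2⟩ hx0
  have h3 : 0 < N x := umbrellaWeight_pos hx0
  have h4 := hquad x.2 (x.1 ^ 2) (sq_nonneg _)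
  have h5 := (Complex.abs_im_le_norm _).trans h1
  rw [Complex.norm_real, Real.norm_eq_abs] at h2
  rw [norm_mul, Real.norm_of_nonneg h3.le] at h1 h2 h5
  rw [Complex.sub_im] at h5
  have h6 := (abs_le.1 h5).2
  have h7 := (abs_le.1 h2).2
  have h8 : 0 < k * (N x * N x) := by positivity
  have h9 : (|x.2| + x.1 ^ 2) ^ 2 = N x * N x := by rw [hN, umbrellaWeight, pow_two]
  rw [h9] at h4
  linarith

end Umbrella

end

section

open Filter Topology Asymptotics

section Symplectic

theorem omegaSt_combination {y v : ℂ × ℂ} (hyv : omegaSt y v = 0) (a b : ℂ) :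
    omegaSt (a * y.1 + b * v.1, a * y.2 + b * v.2) y =
      -(a.im * (Complex.normSq y.1 + Complex.normSq y.2)) -
        b.im * (y.1.re * v.1.re + y.1.im * v.1.im + y.2.re * v.2.re + y.2.im * v.2.im) ∧
    omegaSt (a * y.1 + b * v.1, a * y.2 + b * v.2) v =
      -(a.im * (y.1.re * v.1.re + y.1.im * v.1.im + y.2.re * v.2.re + y.2.im * v.2.im)) -
        b.im * (Complex.normSq v.1 + Complex.normSq v.2) := by
  simp only [omegaSt, Complex.normSq_apply, Complex.add_re, Complex.add_im, Complex.mul_re,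
    Complex.mul_im] at hyv ⊢
  constructor
  · linear_combination -b.re * hyv
  · linear_combination a.re * hyv

/-- A Lagrangian plane in `ℂ²` spanned by `y`, `v` is totally real; in the dual complex coordinates,
the imaginary parts of symplectically conjugate vectors `x`, `u` form a negative definite matrix. -/
theorem exists_dual_coordinates {x u y v : ℂ × ℂ} (hyv : omegaSt y v = 0) (hxy : omegaSt x y = 1)
    (hxv : omegaSt x v = 0) (huv : omegaSt u v = 1) (huy : omegaSt u y = 0) :
    ∃ (z₁ z₂ w₁ w₂ : ℂ) (n₁₁ n₁₂ n₂₂ : ℝ), z₁ * y.1 + z₂ * y.2 = 1 ∧ z₁ * v.1 + z₂ * v.2 = 0 ∧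
      w₁ * y.1 + w₂ * y.2 = 0 ∧ w₁ * v.1 + w₂ * v.2 = 1 ∧
      (z₁ * x.1 + z₂ * x.2).im = -n₁₁ ∧ (w₁ * x.1 + w₂ * x.2).im = -n₁₂ ∧
      (z₁ * u.1 + z₂ * u.2).im = -n₁₂ ∧ (w₁ * u.1 + w₂ * u.2).im = -n₂₂ ∧
      0 < n₁₁ ∧ 0 < n₁₁ * n₂₂ - n₁₂ ^ 2 := by
  set hyy := Complex.normSq y.1 + Complex.normSq y.2 with hyy_def
  set hvv := Complex.normSq v.1 + Complex.normSq v.2 with hvv_def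
  set h := y.1.re * v.1.re + y.1.im * v.1.im + y.2.re * v.2.re + y.2.im * v.2.im with h_def
  set d := y.1 * v.2 - y.2 * v.1 with hd
  have hΔ : hyy * hvv - h ^ 2 = Complex.normSq d := by
    simp only [omegaSt] at hyv
    simp only [hyy_def, hvv_def, h_def, hd, Complex.normSq_apply, Complex.sub_re, Complex.sub_im,
      Complex.mul_re, Complex.mul_im]
    linear_combination (y.1.re * v.1.im - y.1.im * v.1.re + y.2.re * v.2.im - y.2.im * v.2.re) * hyv
  have hd0 : d ≠ 0 := by
    intro h0
    have h1 : d.re = 0 := by rw [h0]; rfl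
    have h2 : d.im = 0 := by rw [h0]; rfl
    simp only [hd, Complex.sub_re, Complex.sub_im, Complex.mul_re, Complex.mul_im] at h1 h2
    have key (p : ℂ × ℂ) : hyy * omegaSt p v = h * omegaSt p y := by
      simp only [omegaSt] at hyv ⊢
      simp only [hyy_def, h_def, Complex.normSq_apply]
      linear_combination (y.1.re * p.1.re + y.1.im * p.1.im + y.2.re * p.2.re + y.2.im * p.2.im) *
          hyv
        + (p.1.re * y.2.im + p.1.im * y.2.re - p.2.re * y.1.im - p.2.im * y.1.re) * h1
        + (p.2.re * y.1.re - p.2.im * y.1.im - p.1.re * y.2.re + p.1.im * y.2.im) * h2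
    have h3 : h = 0 := by simpa [hxv, hxy] using (key x).symm
    have h4 : hyy = 0 := by simpa [huv, huy, h3] using key u
    have h5 : y = 0 := by
      have h6 := Complex.normSq_nonneg y.1
      have h7 := Complex.normSq_nonneg y.2
      exact Prod.ext (Complex.normSq_eq_zero.1 (by linarith)) (Complex.normSq_eq_zero.1 (by
          linarith))
    simp [h5, omegaSt] at hxy
  have hΔ0 : 0 < hyy * hvv - h ^ 2 := by rw [hΔ]; exact Complex.normSq_pos.2 hd0
  have hvv0 : 0 < hvv := by
    have h1 : 0 ≤ hvv := add_nonneg (Complex.normSq_nonneg _) (Complex.normSq_nonneg _)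
    refine h1.lt_of_ne fun h2 => ?_
    rw [← h2] at hΔ0
    nlinarith [sq_nonneg h]
  have hcoord (p : ℂ × ℂ) :
      omegaSt p y = -((v.2 / d * p.1 + -v.1 / d * p.2).im * hyy) -
        (-y.2 / d * p.1 + y.1 / d * p.2).im * h ∧
      omegaSt p v = -((v.2 / d * p.1 + -v.1 / d * p.2).im * h) -
        (-y.2 / d * p.1 + y.1 / d * p.2).im * hvv := by
    convert omegaSt_combination hyv (v.2 / d * p.1 + -v.1 / d * p.2)
      (-y.2 / d * p.1 + y.1 / d * p.2) using 3
    all_goals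
      apply Prod.ext <;> field_simp <;> simp only [hd] <;> ring
  obtain ⟨hx1, hx2⟩ := hcoord x
  obtain ⟨hu1, hu2⟩ := hcoord u
  rw [hxy] at hx1
  rw [hxv] at hx2
  rw [huy] at hu1
  rw [huv] at hu2
  refine ⟨v.2 / d, -v.1 / d, -y.2 / d, y.1 / d, hvv / (hyy * hvv - h ^ 2),
    -h / (hyy * hvv - h ^ 2), hyy / (hyy * hvv - h ^ 2), ?_, ?_, ?_, ?_, ?_, ?_, ?_, ?_,
    by positivity, ?_⟩
  · field_simp
    simp only [hd]
    ring
  · field_simp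
    ring
  · field_simp
    ring
  · field_simp
    simp only [hd]
    ring
  · rw [← neg_div, eq_div_iff hΔ0.ne']
    linear_combination hvv * hx1 - h * hx2
  · rw [← neg_div, eq_div_iff hΔ0.ne']
    linear_combination -h * hx1 + hyy * hx2
  · rw [← neg_div, eq_div_iff hΔ0.ne']
    linear_combination hvv * hu1 - h * hu2
  · rw [← neg_div, eq_div_iff hΔ0.ne']
    linear_combination -h * hu1 + hyy * hu2
  · have : hvv / (hyy * hvv - h ^ 2) * (hyy / (hyy * hvv - h ^ 2)) -
        (-h / (hyy * hvv - h ^ 2)) ^ 2 = (hyy * hvv - h ^ 2)⁻¹ := by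
      field_simp
    rw [this]
    positivity

end Symplectic

section Composition

theorem whitneyPi_eq (x : ℝ × ℝ) : whitneyPi x = x.1 ^ 2 • ((Complex.I, 0) : ℂ × ℂ) +
    (x.1 * x.2) • ((1, 0) : ℂ × ℂ) + (2 / 3 * x.1 ^ 3) • ((0, 1) : ℂ × ℂ) +
    x.2 • ((0, Complex.I) : ℂ × ℂ) := by
  apply Prod.ext <;> apply Complex.ext <;> simp [whitneyPi, -Complex.ofReal_pow]
  ring

theorem contDiff_whitneyPi {n : WithTop ℕ∞} : ContDiff ℝ n whitneyPi := by
  rw [funext whitneyPi_eq]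
  fun_prop

theorem isBigO_smul_const {E α : Type*} [NormedAddCommGroup E] [NormedSpace ℝ E]
    {l : Filter α} {f : α → ℝ} {g : α → ℝ} (h : (fun x => (f x : ℂ)) =O[l] g) (e : E) :
    (fun x => f x • e) =O[l] g := by
  refine (IsBigO.of_bound ‖e‖ (Eventually.of_forall fun x => ?_)).trans h
  rw [norm_smul, Complex.norm_real, mul_comm]

theorem ContinuousLinearMap.isBigO_apply₂ {E F G α : Type*} [NormedAddCommGroup E] [NormedSpace ℝ E]
    [NormedAddCommGroup F] [NormedSpace ℝ F] [NormedAddCommGroup G] [NormedSpace ℝ G]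
    (b : E →L[ℝ] F →L[ℝ] G) {l : Filter α} {f : α → E} {g : α → F} {f' g' : α → ℝ}
    (hf : f =O[l] f') (hg : g =O[l] g') : (fun x => b (f x) (g x)) =O[l] fun x => f' x * g' x := by
  refine (IsBigO.of_bound ‖b‖ (Eventually.of_forall fun x => ?_)).trans
    (hf.norm_left.mul hg.norm_left)
  rw [norm_mul, norm_norm, norm_norm, ← mul_assoc]
  exact b.le_opNorm₂ _ _

/-- Taylor expansions at the origin of a function composed with the Whitney umbrella. -/
theorem ContDiff.exists_taylor_comp_whitneyPi {f : ℂ × ℂ → ℂ} (hf : ContDiff ℝ 2 f)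
    (h0 : f 0 = 0) : ∃ m : ℂ,
    ((fun x => f (whitneyPi x) - (x.1 ^ 2 * fderiv ℝ f 0 (Complex.I, 0) +
      x.1 * x.2 * fderiv ℝ f 0 (1, 0) + 2 / 3 * x.1 ^ 3 * fderiv ℝ f 0 (0, 1) +
      x.2 * fderiv ℝ f 0 (0, Complex.I) + m * x.2 ^ 2))
        =o[𝓝 0] fun x => ‖x‖ * umbrellaWeight x) ∧
    ((fun x => f (whitneyPi x) - (x.1 ^ 2 * fderiv ℝ f 0 (Complex.I, 0) +
      x.1 * x.2 * fderiv ℝ f 0 (1, 0) + 2 / 3 * x.1 ^ 3 * fderiv ℝ f 0 (0, 1) +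
      x.2 * fderiv ℝ f 0 (0, Complex.I))) =O[𝓝 0] fun x => umbrellaWeight x ^ 2) := by
  obtain ⟨b, hb, -⟩ := hf.exists_taylor_two_isLittleO
  set D := fderiv ℝ f 0
  set v : ℂ × ℂ := (0, Complex.I)
  have hr1 : (fun x : ℝ × ℝ => ‖x‖) =o[𝓝 0] fun _ => (1 : ℝ) := isLittleO_norm_one
  have ht : (fun x : ℝ × ℝ => (x.1 : ℂ)) =O[𝓝 0] fun x => ‖x‖ := isBigO_fst_norm
  have hs := isBigO_snd_umbrellaWeight
  have ht2 := isBigO_sq_fst_umbrellaWeight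
  have hNr := isBigO_umbrellaWeight_norm
  set N := umbrellaWeight
  have hN2 : (fun x => N x * N x) =O[𝓝 0] fun x => ‖x‖ * N x := hNr.mul (isBigO_refl N _)
  have hrN : (fun x : ℝ × ℝ => ‖x‖ * N x) =O[𝓝 0] N := by
    simpa using hr1.isBigO.mul (isBigO_refl N (𝓝 0))
  set R : ℝ × ℝ → ℂ × ℂ := fun x => whitneyPi x - x.2 • v with hR
  have hRe (g : ℝ × ℝ → ℝ) (h₁ : (fun x : ℝ × ℝ => (x.1 : ℂ) ^ 2) =O[𝓝 0] g)
      (h₂ : (fun x : ℝ × ℝ => (x.1 : ℂ) * x.2) =O[𝓝 0] g)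
      (h₃ : (fun x : ℝ × ℝ => (x.1 : ℂ) * x.1 ^ 2) =O[𝓝 0] g) : R =O[𝓝 0] g := by
    have h₃' : (fun x : ℝ × ℝ => (2 / 3 : ℂ) * (x.1 : ℂ) ^ 3) =O[𝓝 0] g :=
      (h₃.const_mul_left (2 / 3)).congr_left fun x => by ring
    refine (((isBigO_smul_const (f := fun x : ℝ × ℝ => x.1 ^ 2) (by simpa using h₁)
      ((Complex.I, 0) : ℂ × ℂ)).add
      (isBigO_smul_const (f := fun x : ℝ × ℝ => x.1 * x.2) (by simpa using h₂)
      ((1, 0) : ℂ × ℂ))).add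
      (isBigO_smul_const (f := fun x : ℝ × ℝ => 2 / 3 * x.1 ^ 3) (by simpa using h₃')
      ((0, 1) : ℂ × ℂ))).congr_left fun x => ?_
    simp only [hR, whitneyPi_eq]
    abel
  have hR1 : R =O[𝓝 0] fun x => ‖x‖ * ‖x‖ :=
    hRe _ (by simpa only [pow_two] using ht.mul ht) (ht.mul (hs.trans hNr)) (ht.mul (ht2.trans hNr))
  have hsv : (fun x : ℝ × ℝ => x.2 • v) =O[𝓝 0] N := isBigO_smul_const hs v
  have hπ : whitneyPi =O[𝓝 0] N :=
    ((hRe N ht2 ((ht.mul hs).trans hrN) ((ht.mul ht2).trans hrN)).add hsv).congr_left fun x => by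
      simp only [hR, sub_add_cancel]
  have hπ0 : Tendsto whitneyPi (𝓝 0) (𝓝 0) := by
    refine (contDiff_whitneyPi (n := 0)).continuous.tendsto' _ _ ?_
    rw [whitneyPi_eq]
    simp
  have hg : (fun x => f (whitneyPi x) - D (whitneyPi x) - b (whitneyPi x) (whitneyPi x))
      =o[𝓝 0] fun x => N x * N x := by
    have := (hb.comp_tendsto hπ0).trans_isBigO (hπ.norm_left.pow 2)
    simpa [Function.comp_def, h0, pow_two] using this
  have hD (x : ℝ × ℝ) : D (whitneyPi x) = x.1 ^ 2 * D (Complex.I, 0) + x.1 * x.2 * D (1, 0) +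
      2 / 3 * x.1 ^ 3 * D (0, 1) + x.2 * D v := by
    rw [whitneyPi_eq]
    simp only [map_add, map_smul, Complex.real_smul]
    push_cast
    rfl
  refine ⟨b v v, ?_, ?_⟩
  · have h1 : (fun x => b (whitneyPi x) (R x) + b (R x) (x.2 • v))
        =o[𝓝 0] fun x => ‖x‖ * N x := by
      have e1 := b.isBigO_apply₂ hπ hR1
      have e2 := b.isBigO_apply₂ hR1 hsv
      have e3 : (fun x => ‖x‖ * ‖x‖ * N x) =o[𝓝 0] fun x => ‖x‖ * N x := by
        simpa [mul_assoc] using hr1.mul_isBigO (isBigO_refl (fun x => ‖x‖ * N x) (𝓝 0))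
      exact ((e1.congr_right fun x => by ring).add e2).trans_isLittleO e3
    refine ((hg.trans_isBigO hN2).add h1).congr_left fun x => ?_
    rw [← hD]
    have e4 : b (whitneyPi x) (whitneyPi x) =
        b (whitneyPi x) (R x) + b (R x) (x.2 • v) + b v v * x.2 ^ 2 := by
      have e5 : b (x.2 • v) (x.2 • v) = b v v * x.2 ^ 2 := by
        simp only [map_smul, smul_apply, Complex.real_smul]
        ring
      rw [← e5]
      simp only [hR, map_sub, sub_apply]
      ring
    rw [e4]
    ring
  · simp only [pow_two (N _)]
    refine (hg.isBigO.add (b.isBigO_apply₂ hπ hπ)).congr_left fun x => ?_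
    rw [← hD]
    ring

end Composition

end

section

open Filter Topology Asymptotics

theorem exists_lipschitzWith_extension {E : ℝ × ℝ → ℂ} (hE : ∀ η > 0, ∀ᶠ ρ in 𝓝[>] (0 : ℝ),
    ∀ x y, ‖x‖ ≤ ρ → ‖y‖ ≤ ρ → ‖E x - E y‖ ≤ η * ‖x - y‖) :
    ∀ᶠ ρ in 𝓝[>] (0 : ℝ), ∃ E' : ℝ × ℝ → ℂ, LipschitzWith (1 / 100) E' ∧
      ∀ x, ‖x‖ ≤ ρ → E' x = E x := by
  have hc := lipschitzExtensionConstant_pos ℂ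
  set c := lipschitzExtensionConstant ℂ
  filter_upwards [hE ((1 / 100 / c : NNReal) : ℝ) (by positivity)] with ρ hρ
  have h1 : LipschitzOnWith (1 / 100 / c) E (closedBall 0 ρ) := by
    refine LipschitzOnWith.of_dist_le_mul fun x hx y hy => ?_
    rw [dist_eq_norm, dist_eq_norm]
    exact hρ x y (by simpa using hx) (by simpa using hy)
  obtain ⟨g, hg, hgE⟩ := h1.extend_finite_dimension
  refine ⟨g, ?_, fun x hx => (hgE (by simpa using hx)).symm⟩
  rwa [mul_div_cancel₀ _ hc.ne'] at hg

theorem Subalgebra.eq_top_of_umbrella {K : Set (ℝ × ℝ)} [CompactSpace K]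
    {A : Subalgebra ℂ C(K, ℂ)} (hA : IsClosed (A : Set C(K, ℂ))) {E₁ E₂ V : ℝ × ℝ → ℂ}
    (hE₁ : LipschitzWith (1 / 100) E₁) (hE₂ : LipschitzWith (1 / 100) E₂) {zf wf : C(K, ℂ)}
    (hz : zf ∈ A) (hw : wf ∈ A) {q a c : ℂ} (h₁ : ∀ x : K, V x = x.1.1 + E₁ x + c * wf x)
    (h₂ : ∀ x : K, wf x = x.1.2 + E₂ x) (hV : ∀ x : K, V x ^ 2 = zf x + q * wf x ^ 2)
    (hVw : ∀ x : K, x.1 ≠ 0 → (V x * (wf x + a * zf x)).im < 0) (h0 : 0 ∈ K) (hV0 : V 0 = 0) :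
    A = ⊤ := by
  let v : C(K, ℂ) := ⟨fun x => x.1.1 + E₁ x + c * wf x, by
    have := hE₁.continuous
    fun_prop⟩
  have hv (x : K) : v x = V x := (h₁ x).symm
  have hwA : wf + a • zf ∈ A := A.add_mem hw (A.smul_mem hz a)
  have hvA : v ^ 2 ∈ A := by
    have : v ^ 2 = zf + q • wf ^ 2 := by
      ext x
      simp [hv, hV]
    rw [this]
    exact A.add_mem hz (A.smul_mem (A.pow_mem hw 2) q)
  have hvwA : v * (wf + a • zf) ∈ A := by
    have h3 : Complex.I • (v * (wf + a • zf)) ∈ A := by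
      refine ContinuousMap.mem_of_sq_mem hA ?_ fun x => ?_
      · have : (Complex.I • (v * (wf + a • zf))) ^ 2 = (-1 : ℂ) • (v ^ 2 * (wf + a • zf) ^ 2) := by
          rw [smul_pow, mul_pow, Complex.I_sq]
        rw [this]
        exact A.smul_mem (A.mul_mem hvA (A.pow_mem hwA 2)) _
      · rcases eq_or_ne x.1 0 with h | h
        · right
          simp [hv, h, hV0]
        · left
          have := hVw x h
          simp only [Complex.mul_im, ContinuousMap.smul_apply, ContinuousMap.mul_apply,
              ContinuousMap.add_apply, smul_eq_mul, hv, Complex.mul_re, Complex.I_re,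
              Complex.I_im] at this ⊢
          linarith
    have := A.smul_mem h3 (-Complex.I)
    rwa [smul_smul, neg_mul, Complex.I_mul_I, neg_neg, one_smul] at this
  refine Subalgebra.eq_top_of_adjoin_sqrt hA (x₀ := ⟨0, h0⟩) hwA hvA hvwA (fun x hx => ?_) ?_
  · by_contra hne
    have h3 := hVw x fun h => hne (Subtype.ext h)
    have h4 : wf x + a * zf x = 0 := by simpa using hx
    simp [h4] at h3
  · have hsub : (A : Set C(K, ℂ)) ⊆ (Algebra.adjoin ℂ (insert v (A : Set C(K,
        ℂ)))).topologicalClosure :=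
      ((Set.subset_insert _ _).trans Algebra.subset_adjoin).trans
        (Subalgebra.le_topologicalClosure _)
    refine Subalgebra.eq_top_of_lipschitz_perturbation (Subalgebra.isClosed_topologicalClosure _)
      hE₁ hE₂ (f₁ := v - c • wf) (f₂ := wf) ?_ (hsub hw) (fun x => ?_) h₂
    · exact Subalgebra.sub_mem _ (Subalgebra.le_topologicalClosure _
        (Algebra.subset_adjoin (Set.mem_insert _ _))) (Subalgebra.smul_mem _ (hsub hw) c)
    · simp [v]

theorem exists_mvPolynomial_near_of_closure_eq_top {K : Type*} [TopologicalSpace K] [CompactSpace K]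
    {g : Fin 2 → C(K, ℂ)} (hg : (MvPolynomial.aeval (R := ℂ) g).range.topologicalClosure = ⊤)
    (f : C(K, ℂ)) {δ : ℝ} (hδ : 0 < δ) :
    ∃ P : MvPolynomial (Fin 2) ℂ, ∀ x, ‖f x - MvPolynomial.eval ![g 0 x, g 1 x] P‖ < δ := by
  have hf : f ∈ (MvPolynomial.aeval (R := ℂ) g).range.topologicalClosure := by
    rw [hg]
    exact Algebra.mem_top
  obtain ⟨_, ⟨P, rfl⟩, hP⟩ := Metric.mem_closure_iff.1 hf δ hδ
  refine ⟨P, fun x => ?_⟩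
  have h1 : MvPolynomial.eval ![g 0 x, g 1 x] P = MvPolynomial.aeval g P x := by
    have h2 : (![g 0 x, g 1 x] : Fin 2 → ℂ) = fun i => ContinuousMap.evalAlgHom ℂ ℂ x (g i) := by
      ext i
      fin_cases i <;> rfl
    rw [h2, ← MvPolynomial.coe_aeval_eq_eval, RingHom.coe_coe, ← MvPolynomial.comp_aeval_apply]
    rfl
  rw [h1, ← dist_eq_norm]
  exact (ContinuousMap.dist_apply_le_dist x).trans_lt hP

/-- Near the origin, the Whitney umbrella transported by a symplectomorphism carries a branch of
the square root of a quadratic polynomial in the coordinates of `ℂ²`. -/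
theorem exists_sqrt_of_symplectic {φ : ℂ × ℂ → ℂ × ℂ} (hφ : ContDiff ℝ 2 φ) (hφ0 : φ 0 = 0)
    (hφ_symp : ∀ u v, omegaSt (fderiv ℝ φ 0 u) (fderiv ℝ φ 0 v) = omegaSt u v) :
    ∃ (z₁ z₂ w₁ w₂ q a c : ℂ) (V : ℝ × ℝ → ℂ), ∀ zf wf : ℝ × ℝ → ℂ,
      (∀ x, zf x = z₁ * (φ (whitneyPi x)).1 + z₂ * (φ (whitneyPi x)).2) →
      (∀ x, wf x = w₁ * (φ (whitneyPi x)).1 + w₂ * (φ (whitneyPi x)).2) →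
      V 0 = 0 ∧ (∀ x, V x ^ 2 = zf x + q * wf x ^ 2) ∧
      (∀ᶠ x in 𝓝 0, x ≠ 0 → (V x * (wf x + a * zf x)).im < 0) ∧
      (∀ η > 0, ∀ᶠ ρ in 𝓝[>] (0 : ℝ), ∀ x y, ‖x‖ ≤ ρ → ‖y‖ ≤ ρ →
        ‖(V x - (x.1 + c * x.2)) - (V y - (y.1 + c * y.2))‖ ≤ η * ‖x - y‖) ∧
      ∀ η > 0, ∀ᶠ ρ in 𝓝[>] (0 : ℝ), ∀ x y, ‖x‖ ≤ ρ → ‖y‖ ≤ ρ →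
        ‖(wf x - x.2) - (wf y - y.2)‖ ≤ η * ‖x - y‖ := by
  set L := fderiv ℝ φ 0 with hL
  obtain ⟨z₁, z₂, w₁, w₂, n₁₁, n₁₂, n₂₂, hzy, hzv, hwy, hwv, hX₁, hX₂, hU₁, hU₂, hn, hdet⟩ :=
    exists_dual_coordinates (x := L (1, 0)) (u := L (0, 1)) (y := L (Complex.I, 0))
      (v := L (0, Complex.I)) (by rw [hφ_symp]; simp [omegaSt]) (by rw [hφ_symp]; simp [omegaSt])
      (by rw [hφ_symp]; simp [omegaSt]) (by rw [hφ_symp]; simp [omegaSt])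
      (by rw [hφ_symp]; simp [omegaSt])
  have hcd (a b : ℂ) : ContDiff ℝ 2 fun p => a * (φ p).1 + b * (φ p).2 := by fun_prop
  have hfd (a b : ℂ) (v : ℂ × ℂ) :
      fderiv ℝ (fun p => a * (φ p).1 + b * (φ p).2) 0 v = a * (L v).1 + b * (L v).2 := by
    have h1 : HasFDerivAt φ L 0 := (hφ.differentiable (by norm_num) 0).hasFDerivAt
    have h2 : HasFDerivAt (fun p => a * (φ p).1 + b * (φ p).2) _ 0 :=
      (h1.fst.const_mul a).add (h1.snd.const_mul b)
    rw [h2.fderiv]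
    simp
  obtain ⟨m, hm1, hm2⟩ := (hcd z₁ z₂).exists_taylor_comp_whitneyPi (by simp [hφ0])
  obtain ⟨-, -, hm3⟩ := (hcd w₁ w₂).exists_taylor_comp_whitneyPi (by simp [hφ0])
  simp only [hfd, hzy, hzv, hwy, hwv] at hm1 hm2 hm3
  set zf : ℝ × ℝ → ℂ := fun x => z₁ * (φ (whitneyPi x)).1 + z₂ * (φ (whitneyPi x)).2 with hzf
  set wf : ℝ × ℝ → ℂ := fun x => w₁ * (φ (whitneyPi x)).1 + w₂ * (φ (whitneyPi x)).2 with hwf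
  have hzc : ContDiff ℝ 2 zf := (hcd z₁ z₂).comp contDiff_whitneyPi
  have hwc : ContDiff ℝ 2 wf := (hcd w₁ w₂).comp contDiff_whitneyPi
  have hw1 : (fun x => wf x - (x.2 + x.1 * x.2 * (w₁ * (L (1, 0)).1 + w₂ * (L (1, 0)).2) +
      2 / 3 * x.1 ^ 3 * (w₁ * (L (0, 1)).1 + w₂ * (L (0, 1)).2))) =O[𝓝 0]
      fun x => umbrellaWeight x ^ 2 :=
    hm3.congr_left fun x => by simp only [hwf]; ring
  obtain ⟨q, a, V, hV0, hV, hVw, hVE⟩ := exists_sqrt_of_umbrella (m := m) hzc hwc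
    (hm1.congr_left fun x => by simp only [hzf]; ring)
    (hm2.congr_left fun x => by simp only [hzf]; ring) hw1 hX₁ hX₂ hU₁ hU₂ hn hdet
  refine ⟨z₁, z₂, w₁, w₂, q, a, (z₁ * (L (1, 0)).1 + z₂ * (L (1, 0)).2) / 2, V,
    fun zf' wf' hz' hw' => ?_⟩
  have hz : zf' = zf := funext hz'
  have hw : wf' = wf := funext hw'
  rw [hz, hw]
  exact ⟨hV0, hV, hVw, hVE, fun η hη => norm_sub_sub_snd_le hwc hw1 hη⟩

theorem exists_lipschitzWith_of_symplectic {φ : ℂ × ℂ → ℂ × ℂ} (hφ : ContDiff ℝ 2 φ)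
    (hφ0 : φ 0 = 0)
    (hφ_symp : ∀ u v, omegaSt (fderiv ℝ φ 0 u) (fderiv ℝ φ 0 v) = omegaSt u v) :
    ∃ (z₁ z₂ w₁ w₂ q a c : ℂ) (V : ℝ × ℝ → ℂ) (ρ : ℝ) (E₁ E₂ : ℝ × ℝ → ℂ), 0 < ρ ∧
      LipschitzWith (1 / 100) E₁ ∧ LipschitzWith (1 / 100) E₂ ∧ V 0 = 0 ∧
      (∀ x, V x ^ 2 = z₁ * (φ (whitneyPi x)).1 + z₂ * (φ (whitneyPi x)).2 +
        q * (w₁ * (φ (whitneyPi x)).1 + w₂ * (φ (whitneyPi x)).2) ^ 2) ∧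
      ∀ x, ‖x‖ ≤ ρ →
        V x = x.1 + E₁ x + c * (w₁ * (φ (whitneyPi x)).1 + w₂ * (φ (whitneyPi x)).2) ∧
        w₁ * (φ (whitneyPi x)).1 + w₂ * (φ (whitneyPi x)).2 = x.2 + E₂ x ∧
        (x ≠ 0 → (V x * (w₁ * (φ (whitneyPi x)).1 + w₂ * (φ (whitneyPi x)).2 +
          a * (z₁ * (φ (whitneyPi x)).1 + z₂ * (φ (whitneyPi x)).2))).im < 0) := by
  obtain ⟨z₁, z₂, w₁, w₂, q, a, c, V, hloc⟩ := exists_sqrt_of_symplectic hφ hφ0 hφ_symp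
  obtain ⟨hV0, hV, hVw, hVE, hwE⟩ := hloc _ _ (fun _ => rfl) (fun _ => rfl)
  obtain ⟨r, hr, hVr⟩ := Metric.eventually_nhds_iff.1 hVw
  set wf : ℝ × ℝ → ℂ := fun x => w₁ * (φ (whitneyPi x)).1 + w₂ * (φ (whitneyPi x)).2
  have hE₁ : ∀ η > 0, ∀ᶠ ρ in 𝓝[>] (0 : ℝ), ∀ x y : ℝ × ℝ, ‖x‖ ≤ ρ → ‖y‖ ≤ ρ →
      ‖(V x - x.1 - c * wf x) - (V y - y.1 - c * wf y)‖ ≤ η * ‖x - y‖ := by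
    intro η hη
    filter_upwards [hVE (η / 2) (by positivity), hwE (η / 2 / (‖c‖ + 1)) (by positivity)]
      with ρ h1 h2 x y hx hy
    calc ‖(V x - x.1 - c * wf x) - (V y - y.1 - c * wf y)‖
        = ‖((V x - (x.1 + c * x.2)) - (V y - (y.1 + c * y.2))) -
            c * ((wf x - x.2) - (wf y - y.2))‖ := by congr 1; ring
      _ ≤ η / 2 * ‖x - y‖ + ‖c‖ * (η / 2 / (‖c‖ + 1) * ‖x - y‖) := by
          refine (norm_sub_le _ _).trans (add_le_add (h1 x y hx hy) ?_)
          rw [norm_mul]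
          gcongr
          exact h2 x y hx hy
      _ = (η / 2 + η / 2 * (‖c‖ / (‖c‖ + 1))) * ‖x - y‖ := by ring
      _ ≤ (η / 2 + η / 2 * 1) * ‖x - y‖ := by
          gcongr
          exact div_le_one_of_le₀ (by linarith) (by positivity)
      _ = η * ‖x - y‖ := by ring
  obtain ⟨ρ, ⟨E₁, hE₁, hE₁'⟩, ⟨E₂, hE₂, hE₂'⟩, hρ0, hρr⟩ :=
    ((exists_lipschitzWith_extension hE₁).and
      ((exists_lipschitzWith_extension hwE).and (Ioo_mem_nhdsGT hr))).exists
  refine ⟨z₁, z₂, w₁, w₂, q, a, c, V, ρ, E₁, E₂, hρ0, hE₁, hE₂, hV0, hV, fun x hx =>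
    ⟨?_, ?_, hVr (by simpa using hx.trans_lt hρr)⟩⟩
  · rw [hE₁' x hx]
    ring
  · rw [hE₂' x hx]
    ring

theorem exists_closedBall_preimage_subset {φ : ℂ × ℂ → ℂ × ℂ} (hφ : Function.Bijective φ)
    (hφ' : Continuous (Function.invFun φ)) {ρ : ℝ} (hρ : 0 < ρ) :
    ∃ ε > 0, ∀ x, φ (whitneyPi x) ∈ closedBall (φ 0) ε → ‖x‖ ≤ ρ := by
  have hinv : Function.LeftInverse (Function.invFun φ) φ := Function.leftInverse_invFun hφ.1
  set κ := min (ρ ^ 2) ρ with hκ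
  have hκ0 : 0 < κ := by positivity
  have h1 : Function.invFun φ ⁻¹' ball 0 κ ∈ 𝓝 (φ 0) :=
    hφ'.continuousAt.preimage_mem_nhds (by rw [hinv]; exact ball_mem_nhds _ hκ0)
  obtain ⟨ε, hε, hball⟩ := nhds_basis_closedBall.mem_iff.1 h1
  refine ⟨ε, hε, fun x hx => ?_⟩
  have h2 : ‖whitneyPi x‖ < κ := by simpa [hinv (whitneyPi x)] using hball hx
  have h3 : x.1 ^ 2 < κ := by
    have := (Complex.abs_im_le_norm _).trans_lt ((norm_fst_le _).trans_lt h2)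
    simpa [whitneyPi] using this
  have h4 : |x.2| < κ := by
    have := (Complex.abs_im_le_norm _).trans_lt ((norm_snd_le _).trans_lt h2)
    simpa [whitneyPi] using this
  rw [Prod.norm_def, Real.norm_eq_abs, Real.norm_eq_abs]
  exact max_le (abs_le_of_sq_le_sq (h3.le.trans (min_le_left _ _)) hρ.le)
    (h4.le.trans (min_le_right _ _))

end

/-- For a smooth symplectomorphism `φ` of `ℂ²` and the standard open Whitney umbrella `Σ`,
there exists `ε > 0` such that every continuous function on `φ(Σ) ∩ B̄(φ(0), ε)` can be
uniformly approximated on this set by holomorphic polynomials in two variables. -/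
theorem open_whitney_umbrella_polynomial_approximation
    (φ : ℂ × ℂ → ℂ × ℂ)
    (hφ_smooth : ContDiff ℝ (⊤ : ℕ∞) φ)
    (hφ_bij : Function.Bijective φ)
    (hφ_inv_smooth : ContDiff ℝ (⊤ : ℕ∞) (Function.invFun φ))
    (hφ_symp : ∀ p u v : ℂ × ℂ,
      omegaSt (fderiv ℝ φ p u) (fderiv ℝ φ p v) = omegaSt u v) :
    ∃ ε > 0, ∀ f : ℂ × ℂ → ℂ,
      ContinuousOn f ((φ '' Set.range whitneyPi) ∩ closedBall (φ 0) ε) →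
      ∀ δ > 0, ∃ P : MvPolynomial (Fin 2) ℂ,
        ∀ z ∈ (φ '' Set.range whitneyPi) ∩ closedBall (φ 0) ε,
          ‖f z - MvPolynomial.eval ![z.1, z.2] P‖ < δ := by
  have hφ2 : ContDiff ℝ 2 (fun p => φ p - φ 0) :=
    (contDiff_infty.1 hφ_smooth 2).sub contDiff_const
  obtain ⟨z₁, z₂, w₁, w₂, q, a, c, V, ρ, E₁, E₂, hρ0, hE₁, hE₂, hV0, hV, hρ⟩ :=
    exists_lipschitzWith_of_symplectic hφ2 (sub_self _)
      (by simpa only [fderiv_sub_const] using hφ_symp 0)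
  obtain ⟨ε, hε, hK⟩ := exists_closedBall_preimage_subset hφ_bij hφ_inv_smooth.continuous hρ0
  refine ⟨ε, hε, fun f hf δ hδ => ?_⟩
  have hc : Continuous fun x => φ (whitneyPi x) :=
    hφ_smooth.continuous.comp (contDiff_whitneyPi (n := 0)).continuous
  set K : Set (ℝ × ℝ) := (fun x => φ (whitneyPi x)) ⁻¹' closedBall (φ 0) ε with hKd
  have hKc : IsCompact K := (isCompact_closedBall (0 : ℝ × ℝ) ρ).of_isClosed_subset
    (isClosed_closedBall.preimage hc) fun x hx => by simpa using hK x hx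
  have : CompactSpace K := isCompact_iff_compactSpace.1 hKc
  have hcK : Continuous fun x : K => φ (whitneyPi x) := hc.comp continuous_subtype_val
  set g : Fin 2 → C(K, ℂ) := ![⟨fun x => (φ (whitneyPi x)).1, hcK.fst⟩,
    ⟨fun x => (φ (whitneyPi x)).2, hcK.snd⟩] with hg
  set A := (MvPolynomial.aeval (R := ℂ) g).range.topologicalClosure with hA
  have hgA (i : Fin 2) : g i ∈ A := Subalgebra.le_topologicalClosure _
    ⟨MvPolynomial.X i, MvPolynomial.aeval_X g i⟩
  have hlin (b d : ℂ) : b • (g 0 - algebraMap ℂ C(K, ℂ) (φ 0).1) +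
      d • (g 1 - algebraMap ℂ C(K, ℂ) (φ 0).2) ∈ A :=
    A.add_mem (A.smul_mem (A.sub_mem (hgA 0) (A.algebraMap_mem _)) b)
      (A.smul_mem (A.sub_mem (hgA 1) (A.algebraMap_mem _)) d)
  have hπ0 : whitneyPi 0 = 0 := by
    rw [whitneyPi_eq]
    simp
  have htop : A = ⊤ := by
    refine Subalgebra.eq_top_of_umbrella (Subalgebra.isClosed_topologicalClosure _) hE₁ hE₂
      (hlin z₁ z₂) (hlin w₁ w₂) (V := V) (q := q) (a := a) (c := c) (fun x => ?_) (fun x => ?_)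
      (fun x => ?_) (fun x hx => ?_) (by simp [hKd, hπ0, hε.le]) hV0
    · simpa [hg] using (hρ x (hK x x.2)).1
    · simpa [hg] using (hρ x (hK x x.2)).2.1
    · rw [hV]
      simp [hg]
    · simpa [hg] using (hρ x (hK x x.2)).2.2 hx
  obtain ⟨P, hP⟩ := exists_mvPolynomial_near_of_closure_eq_top htop
    ⟨fun x : K => f (φ (whitneyPi x)),
      hf.comp_continuous hcK fun x => ⟨⟨_, ⟨_, rfl⟩, rfl⟩, x.2⟩⟩ hδ
  refine ⟨P, ?_⟩
  rintro _ ⟨⟨_, ⟨x, rfl⟩, rfl⟩, hx⟩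
  simpa [hg] using hP ⟨x, hx⟩
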